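/- arXiv:2412.07952 — 3 statements merged into one kernel-verified Lean document; each statement's English description precedes it below -/
import Mathlib

section
/- For Cartesian hyperplane parametrization, the Haar measure on affine hyperplanes satisfies μ_{d−1}(dσ) = (2/ω_d)‖η‖^{−(1+d)} λ_d(dη), where ω_d is the surface area of the unit (d−1)-sphere. -/
open MeasureTheory Matrix

/-- The closed half-space of all `η` whose hyperplane `{x | η ⬝ᵥ x = 1}` meets the segment from
the origin to `q`. -/
def separatingSet {d : ℕ} (q : Fin d → ℝ) : Set (Fin d → ℝ) := {η | 1 ≤ η ⬝ᵥ q}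

lemma measurable_dotProduct_const {d : ℕ} (q : Fin d → ℝ) :
    Measurable fun η : Fin d → ℝ => η ⬝ᵥ q := by
  simp only [dotProduct]; fun_prop

lemma measurableSet_separatingSet {d : ℕ} (q : Fin d → ℝ) :
    MeasurableSet (separatingSet q) :=
  measurableSet_le measurable_const (measurable_dotProduct_const q)

/-- A finite measure on the line is determined by its total mass and its values on closed
half-lines not containing `0`. -/
lemma Real.measure_ext_of_Ici_of_Iic {μ ν : Measure ℝ} [IsFiniteMeasure μ] [IsFiniteMeasure ν]
    (huniv : μ Set.univ = ν Set.univ) (hIci : ∀ t > 0, μ (Set.Ici t) = ν (Set.Ici t))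
    (hIic : ∀ t < 0, μ (Set.Iic t) = ν (Set.Iic t)) : μ = ν := by
  refine Measure.ext_of_Ici _ _ fun t => ?_
  rcases lt_or_ge 0 t with ht | ht
  · exact hIci t ht
  have hU : (⋃ n : ℕ, Set.Iic (t - 1 / ((n : ℝ) + 1))) = Set.Iio t := by
    ext x
    simp only [Set.mem_iUnion, Set.mem_Iic, Set.mem_Iio]
    constructor
    · rintro ⟨n, hn⟩
      have : 0 < 1 / ((n : ℝ) + 1) := by positivity
      linarith
    · intro hx
      obtain ⟨n, hn⟩ := exists_nat_one_div_lt (sub_pos.2 hx)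
      exact ⟨n, by linarith⟩
  have hmono : Monotone fun n : ℕ => Set.Iic (t - 1 / ((n : ℝ) + 1)) := by
    intro m n hmn
    refine Set.Iic_subset_Iic.2 ?_
    have := Nat.one_div_le_one_div (α := ℝ) hmn
    linarith
  have hIio : μ (Set.Iio t) = ν (Set.Iio t) := by
    rw [← hU, hmono.measure_iUnion, hmono.measure_iUnion]
    congr 1
    ext n
    refine hIic _ ?_
    have : 0 < 1 / ((n : ℝ) + 1) := by positivity
    linarith
  rw [← Set.compl_Iio, measure_compl measurableSet_Iio (measure_ne_top _ _),
    measure_compl measurableSet_Iio (measure_ne_top _ _), huniv, hIio]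

/-- A version of the Cramér–Wold theorem: a finite measure is determined by its total mass and
its values on half-spaces not containing the origin. -/
lemma measure_ext_of_separatingSet {d : ℕ} {μ ν : Measure (Fin d → ℝ)} [IsFiniteMeasure μ]
    [IsFiniteMeasure ν] (huniv : μ Set.univ = ν Set.univ)
    (h : ∀ q, μ (separatingSet q) = ν (separatingSet q)) : μ = ν := by
  refine Measure.ext_of_charFunDual <| funext fun L => ?_
  rw [charFunDual_eq_charFun_map_one, charFunDual_eq_charFun_map_one]
  obtain ⟨q, hq⟩ : ∃ q : Fin d → ℝ, ∀ η, L η = η ⬝ᵥ q := by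
    refine ⟨fun i => L (Pi.single i 1), fun η => ?_⟩
    conv_lhs => rw [pi_eq_sum_univ' η]
    simp [dotProduct]
  have hL : Measurable L := L.continuous.measurable
  have hs : ∀ t : ℝ, t ≠ 0 → ∀ η : Fin d → ℝ, η ⬝ᵥ (t⁻¹ • q) = L η / t := by
    intro t _ η
    rw [hq, dotProduct_smul, smul_eq_mul, div_eq_inv_mul]
  congr 1
  refine Real.measure_ext_of_Ici_of_Iic ?_ ?_ ?_
  · rw [Measure.map_apply hL .univ, Measure.map_apply hL .univ]
    simpa using huniv
  · intro t ht
    rw [Measure.map_apply hL measurableSet_Ici, Measure.map_apply hL measurableSet_Ici]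
    have : L ⁻¹' Set.Ici t = separatingSet (t⁻¹ • q) := by
      ext η
      simp only [separatingSet, Set.mem_preimage, Set.mem_Ici, Set.mem_ofPred_eq]
      rw [hs t ht.ne', one_le_div ht]
    rw [this, h]
  · intro t ht
    rw [Measure.map_apply hL measurableSet_Iic, Measure.map_apply hL measurableSet_Iic]
    have : L ⁻¹' Set.Iic t = separatingSet (t⁻¹ • q) := by
      ext η
      simp only [separatingSet, Set.mem_preimage, Set.mem_Iic, Set.mem_ofPred_eq]
      rw [hs t ht.ne, one_le_div_of_neg ht]
    rw [this, h]

lemma iUnion_separatingSet_eq {d : ℕ} :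
    (⋃ p : Fin d × ℤ, separatingSet (Pi.single p.1 (p.2 : ℝ))) = ({0}ᶜ : Set (Fin d → ℝ)) := by
  ext η
  simp only [separatingSet, Set.mem_iUnion, Set.mem_ofPred_eq, Set.mem_compl_iff,
    Set.mem_singleton_iff, dotProduct_single]
  constructor
  · rintro ⟨p, hp⟩ rfl
    norm_num at hp
  · intro hη
    obtain ⟨i, hi⟩ := Function.ne_iff.1 hη
    rcases lt_or_gt_of_ne hi with hi | hi
    · obtain ⟨n, hn⟩ := exists_nat_ge (-(η i))⁻¹
      refine ⟨(i, -n), ?_⟩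
      have hi' : 0 < - η i := by simpa using hi
      have := (inv_le_iff_one_le_mul₀' hi').1 hn
      push_cast
      linarith
    · obtain ⟨n, hn⟩ := exists_nat_ge (η i)⁻¹
      exact ⟨(i, n), by simpa using (inv_le_iff_one_le_mul₀' (by simpa using hi)).1 hn⟩

/-- Away from the origin, a measure is determined by its values on pairwise intersections of
half-spaces not containing the origin. -/
lemma restrict_compl_zero_eq_of_separatingSet_inter {d : ℕ} {μ ν : Measure (Fin d → ℝ)}
    (hμ : ∀ q, μ (separatingSet q) ≠ ⊤)
    (h : ∀ p q, μ (separatingSet p ∩ separatingSet q) = ν (separatingSet p ∩ separatingSet q)) :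
    μ.restrict {0}ᶜ = ν.restrict {0}ᶜ := by
  rw [← iUnion_separatingSet_eq, Measure.restrict_iUnion_congr]
  intro p
  have hself (q : Fin d → ℝ) : μ (separatingSet q) = ν (separatingSet q) := by
    simpa using h q q
  have : IsFiniteMeasure (μ.restrict (separatingSet (Pi.single p.1 (p.2 : ℝ)))) :=
    ⟨by simpa using (hμ _).lt_top⟩
  have : IsFiniteMeasure (ν.restrict (separatingSet (Pi.single p.1 (p.2 : ℝ)))) :=
    ⟨by simpa [← hself] using (hμ _).lt_top⟩
  refine measure_ext_of_separatingSet (by simpa using hself _) fun q => ?_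
  rw [Measure.restrict_apply (measurableSet_separatingSet q),
    Measure.restrict_apply (measurableSet_separatingSet q)]
  exact h _ _

/-- The translation by `b` of affine hyperplanes, in the Cartesian parametrization. -/
noncomputable def hyperplaneTranslation {d : ℕ} (b η : Fin d → ℝ) : Fin d → ℝ :=
  (1 + b ⬝ᵥ η)⁻¹ • η

/-- Invariance under rotations and translations of a measure on hyperplanes in the Cartesian
parametrization, together with negligibility of the hyperplanes through a given point. -/
structure IsMotionInvariant {d : ℕ} (ν : Measure (Fin d → ℝ)) : Prop where
  null : ∀ q, ν {η | η ⬝ᵥ q = 1} = 0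
  translation : ∀ b, MeasurePreserving (hyperplaneTranslation b) ν ν
  rotation : ∀ M : Matrix (Fin d) (Fin d) ℝ, Mᵀ * M = 1 → M.det = 1 →
    MeasurePreserving M.mulVec ν ν

lemma restrict_compl_zero_eq_of_symmDiff {d : ℕ} {μ ν : Measure (Fin d → ℝ)}
    (hμ : ∀ p q, μ (symmDiff (separatingSet p) (separatingSet q)) = μ (separatingSet (q - p)))
    (hν : ∀ p q, ν (symmDiff (separatingSet p) (separatingSet q)) = ν (separatingSet (q - p)))
    (hfin : ∀ q, μ (separatingSet q) ≠ ⊤) (h : ∀ q, μ (separatingSet q) = ν (separatingSet q)) :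
    μ.restrict {0}ᶜ = ν.restrict {0}ᶜ := by
  refine restrict_compl_zero_eq_of_separatingSet_inter hfin fun p q => ?_
  have key (ν : Measure (Fin d → ℝ)) (hν : ∀ p q,
      ν (symmDiff (separatingSet p) (separatingSet q)) = ν (separatingSet (q - p))) :
      2 * ν (separatingSet p ∩ separatingSet q) + ν (separatingSet (q - p))
        = ν (separatingSet p) + ν (separatingSet q) := by
    have mp := measurableSet_separatingSet p
    have mq := measurableSet_separatingSet q
    rw [← hν, measure_symmDiff_eq mp.nullMeasurableSet mq.nullMeasurableSet,
      ← measure_inter_add_sdiff (separatingSet p) mq,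
      ← measure_inter_add_sdiff (separatingSet q) mp, Set.inter_comm (separatingSet q)]
    ring
  have h1 := key μ hμ
  have h2 := key ν hν
  rw [← h p, ← h q, ← h1, ← h] at h2
  have h3 := (ENNReal.add_left_inj (hfin _)).1 h2
  exact ((ENNReal.mul_right_inj two_ne_zero ENNReal.ofNat_ne_top).1 h3).symm

namespace IsMotionInvariant

variable {d : ℕ} {ν : Measure (Fin d → ℝ)}

lemma measure_symmDiff_separatingSet (hν : IsMotionInvariant ν) (p q : Fin d → ℝ) :
    ν (symmDiff (separatingSet p) (separatingSet q)) = ν (separatingSet (q - p)) := by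
  rw [← (hν.translation p).measure_preimage ((measurableSet_separatingSet p).symmDiff
    (measurableSet_separatingSet q)).nullMeasurableSet]
  refine measure_congr ?_
  have h1 : ∀ᵐ η ∂ν, ¬ η ⬝ᵥ (-p) = 1 := by simpa [ae_iff] using hν.null (-p)
  have h2 : ∀ᵐ η ∂ν, ¬ η ⬝ᵥ (q - p) = 1 := by simpa [ae_iff] using hν.null (q - p)
  filter_upwards [h1, h2] with η h1 h2
  refine propext ?_
  change hyperplaneTranslation p η ∈ separatingSet p ∧
      ¬ hyperplaneTranslation p η ∈ separatingSet q ∨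
    hyperplaneTranslation p η ∈ separatingSet q ∧
      ¬ hyperplaneTranslation p η ∈ separatingSet p ↔ η ∈ separatingSet (q - p)
  simp only [separatingSet, Set.mem_ofPred_eq,
    hyperplaneTranslation, smul_dotProduct, smul_eq_mul, dotProduct_comm p η, dotProduct_sub,
    dotProduct_neg, ← div_eq_inv_mul] at h1 h2 ⊢
  generalize η ⬝ᵥ p = a at *
  generalize η ⬝ᵥ q = c at *
  rcases lt_trichotomy (1 + a) 0 with hs | hs | hs
  · rw [one_le_div_of_neg hs, one_le_div_of_neg hs]
    constructor
    · rintro (h | h) <;> linarith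
    · intro h
      have : 1 < c - a := lt_of_le_of_ne h (Ne.symm h2)
      exact Or.inl ⟨by linarith, by linarith⟩
  · exact absurd (by linarith) h1
  · rw [one_le_div hs, one_le_div hs]
    constructor
    · rintro (h | h) <;> linarith
    · intro h
      exact Or.inr ⟨by linarith, by linarith⟩

lemma measure_separatingSet_neg (hν : IsMotionInvariant ν) (q : Fin d → ℝ) :
    ν (separatingSet (-q)) = ν (separatingSet q) := by
  have h1 := hν.measure_symmDiff_separatingSet 0 q
  have h2 := hν.measure_symmDiff_separatingSet q 0
  rw [symmDiff_comm, h1] at h2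
  simpa using h2.symm

lemma measure_separatingSet_mulVec (hν : IsMotionInvariant ν) {M : Matrix (Fin d) (Fin d) ℝ}
    (hM : Mᵀ * M = 1) (hdet : M.det = 1) (q : Fin d → ℝ) :
    ν (separatingSet (M *ᵥ q)) = ν (separatingSet q) := by
  rw [← (hν.rotation M hM hdet).measure_preimage
    (measurableSet_separatingSet (M *ᵥ q)).nullMeasurableSet]
  congr 1
  ext η
  simp only [separatingSet, Set.mem_preimage, Set.mem_ofPred_eq]
  rw [dotProduct_mulVec, ← mulVec_transpose, mulVec_mulVec, hM, one_mulVec]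

lemma separatingSet_smul_subset {s t : ℝ} (hs : 0 ≤ s) (hst : s ≤ t) (q : Fin d → ℝ) :
    separatingSet (s • q) ⊆ separatingSet (t • q) := by
  intro η h
  simp only [separatingSet, Set.mem_ofPred_eq, dotProduct_smul, smul_eq_mul] at h ⊢
  have : 0 < η ⬝ᵥ q := by
    by_contra! h'
    nlinarith [mul_nonneg hs (neg_nonneg.2 h')]
  nlinarith

lemma measure_separatingSet_add_smul (hν : IsMotionInvariant ν) {s t : ℝ} (hs : 0 ≤ s)
    (ht : 0 ≤ t) (q : Fin d → ℝ) :
    ν (separatingSet ((s + t) • q)) = ν (separatingSet (s • q)) + ν (separatingSet (t • q)) := by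
  have hsub : separatingSet (s • q) ⊆ separatingSet ((s + t) • q) :=
    separatingSet_smul_subset hs (by linarith) q
  have h := hν.measure_symmDiff_separatingSet (s • q) ((s + t) • q)
  rw [symmDiff_of_le hsub, ← sub_smul, add_sub_cancel_left] at h
  have h' := measure_sdiff_add_inter (μ := ν) (separatingSet ((s + t) • q))
    (measurableSet_separatingSet (s • q))
  rw [Set.inter_eq_right.2 hsub, h] at h'
  rw [← h', add_comm]

lemma measure_separatingSet_zero : ν (separatingSet (0 : Fin d → ℝ)) = 0 := by
  have : separatingSet (0 : Fin d → ℝ) = ∅ := by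
    ext η
    simp [separatingSet, not_le.2 (zero_lt_one (α := ℝ))]
  simp [this]

lemma measure_separatingSet_natCast_smul (hν : IsMotionInvariant ν) (n : ℕ) (q : Fin d → ℝ) :
    ν (separatingSet ((n : ℝ) • q)) = n * ν (separatingSet q) := by
  induction n with
  | zero => simp [measure_separatingSet_zero]
  | succ n ih =>
    push_cast
    rw [hν.measure_separatingSet_add_smul n.cast_nonneg zero_le_one, ih, one_smul]
    ring

lemma measure_separatingSet_ne_top (hν : IsMotionInvariant ν)
    (hball : ν {η | 1 ≤ η ⬝ᵥ η} ≠ ⊤) (q : Fin d → ℝ) : ν (separatingSet q) ≠ ⊤ := by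
  obtain ⟨n, hn⟩ := exists_nat_ge (q ⬝ᵥ q)
  have hn' : (0 : ℝ) < ((n + 1 : ℕ) : ℝ) := by positivity
  have hq : q = ((n + 1 : ℕ) : ℝ) • (((n + 1 : ℕ) : ℝ)⁻¹ • q) := by
    rw [smul_smul, mul_inv_cancel₀ hn'.ne', one_smul]
  rw [hq, hν.measure_separatingSet_natCast_smul]
  refine ENNReal.mul_ne_top (ENNReal.natCast_ne_top _)
    (ne_top_of_le_ne_top hball (measure_mono fun η hη => ?_))
  simp only [separatingSet, Set.mem_ofPred_eq, dotProduct_smul, smul_eq_mul,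
    ← div_eq_inv_mul, one_le_div hn'] at hη ⊢
  have hcs : (η ⬝ᵥ q) ^ 2 ≤ (η ⬝ᵥ η) * (q ⬝ᵥ q) := by
    simpa [dotProduct, sq] using Finset.sum_mul_sq_le_sq_mul_sq Finset.univ η q
  have h0 : 0 ≤ η ⬝ᵥ η := by
    simpa [dotProduct] using Finset.sum_nonneg fun i _ => mul_self_nonneg (η i)
  push_cast at hη
  by_contra! h
  have hn0 : (0 : ℝ) ≤ n := n.cast_nonneg
  nlinarith [mul_le_mul_of_nonneg_left hn h0]

lemma measure_separatingSet_smul (hν : IsMotionInvariant ν)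
    (hfin : ∀ q, ν (separatingSet q) ≠ ⊤) {t : ℝ} (ht : 0 ≤ t) (q : Fin d → ℝ) :
    ν (separatingSet (t • q)) = ENNReal.ofReal t * ν (separatingSet q) := by
  set f : ℝ → ℝ := fun t => (ν (separatingSet (t • q))).toReal with hf
  have hmono {s t : ℝ} (hs : 0 ≤ s) (hst : s ≤ t) : f s ≤ f t :=
    ENNReal.toReal_mono (hfin _) (measure_mono (separatingSet_smul_subset hs hst q))
  have hmul (n : ℕ) (s : ℝ) : f (n * s) = n * f s := by
    simp only [hf, mul_smul]
    rw [hν.measure_separatingSet_natCast_smul]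
    simp
  have hcast (n : ℕ) : f n = n * f 1 := by simpa using hmul n 1
  have hf1 : 0 ≤ f 1 := ENNReal.toReal_nonneg
  have hbound (n : ℕ) : n * |f t - t * f 1| ≤ f 1 := by
    have hnt : 0 ≤ n * t := by positivity
    have h1 := hmono (Nat.cast_nonneg _) (Nat.floor_le hnt)
    have h2 := hmono hnt (Nat.lt_floor_add_one (n * t)).le
    have h3 := hcast (⌊n * t⌋₊ + 1)
    push_cast at h3
    rw [hmul] at h1 h2
    rw [hcast] at h1
    rw [h3] at h2
    have h4 := mul_le_mul_of_nonneg_right (Nat.floor_le hnt) hf1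
    have h5 := mul_le_mul_of_nonneg_right (Nat.lt_floor_add_one (n * t)).le hf1
    rw [← Nat.abs_cast n, ← abs_mul, abs_le]
    constructor <;> linarith
  have hlin : f t = t * f 1 := by
    by_contra hne
    have hpos : 0 < |f t - t * f 1| := abs_pos.2 (sub_ne_zero.2 hne)
    obtain ⟨n, hn⟩ := exists_nat_gt (f 1 / |f t - t * f 1|)
    rw [div_lt_iff₀ hpos] at hn
    exact absurd (hbound n) (not_le.2 hn)
  rw [← ENNReal.ofReal_toReal (hfin (t • q)), ← ENNReal.ofReal_toReal (hfin q),
    ← ENNReal.ofReal_mul ht]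
  simpa [hf] using congrArg ENNReal.ofReal hlin

end IsMotionInvariant

/-- The matrix of the reflection in the hyperplane orthogonal to `v`. -/
noncomputable def householder {d : ℕ} (v : Fin d → ℝ) : Matrix (Fin d) (Fin d) ℝ :=
  1 - (2 / (v ⬝ᵥ v)) • vecMulVec v v

lemma det_one_sub_smul_vecMulVec {d : ℕ} (c : ℝ) (u v : Fin d → ℝ) :
    (1 - c • vecMulVec u v).det = 1 - c * (v ⬝ᵥ u) := by
  have h := det_one_add_replicateCol_mul_replicateRow (ι := Unit) (-(c • u)) v
  rw [dotProduct_neg, dotProduct_smul, smul_eq_mul, ← sub_eq_add_neg] at h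
  rw [← h]
  congr 1
  ext i j
  simp [vecMulVec_apply, Matrix.mul_apply]
  ring

lemma householder_mulVec {d : ℕ} (v x : Fin d → ℝ) :
    householder v *ᵥ x = x - (2 / (v ⬝ᵥ v) * (v ⬝ᵥ x)) • v := by
  simp [householder, sub_mulVec, smul_mulVec, vecMulVec_mulVec, smul_smul, mul_comm]

lemma householder_transpose_mul_self {d : ℕ} {v : Fin d → ℝ} (hv : v ⬝ᵥ v ≠ 0) :
    (householder v)ᵀ * householder v = 1 := by
  have ht : (householder v)ᵀ = householder v := by
    simp [householder, transpose_vecMulVec]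
  rw [ht, ← mulVec_injective.eq_iff]
  funext x
  rw [← mulVec_mulVec, householder_mulVec, householder_mulVec, one_mulVec, dotProduct_sub,
    dotProduct_smul, smul_eq_mul, sub_sub, ← add_smul]
  have : 2 / (v ⬝ᵥ v) * (v ⬝ᵥ x) + 2 / (v ⬝ᵥ v) *
      (v ⬝ᵥ x - 2 / (v ⬝ᵥ v) * (v ⬝ᵥ x) * (v ⬝ᵥ v)) = 0 := by
    field_simp
    ring
  simp [this]

lemma det_householder {d : ℕ} {v : Fin d → ℝ} (hv : v ⬝ᵥ v ≠ 0) :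
    (householder v).det = -1 := by
  rw [householder, det_one_sub_smul_vecMulVec, div_mul_cancel₀ _ hv]
  norm_num

/-- The rotation group acts transitively, up to sign, on each sphere. -/
lemma exists_rotation_mulVec_eq_or_eq_neg {d : ℕ} {u e : Fin d → ℝ} (h : u ⬝ᵥ u = e ⬝ᵥ e) :
    ∃ M : Matrix (Fin d) (Fin d) ℝ, Mᵀ * M = 1 ∧ M.det = 1 ∧ (M *ᵥ u = e ∨ M *ᵥ u = -e) := by
  by_cases hue : u = e
  · exact ⟨1, by simp, by simp, Or.inl (by simp [hue])⟩
  have he : e ⬝ᵥ e ≠ 0 := by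
    intro h0
    rw [h0] at h
    exact hue ((dotProduct_self_eq_zero.1 h).trans (dotProduct_self_eq_zero.1 h0).symm)
  have hv : (u - e) ⬝ᵥ (u - e) ≠ 0 := by
    rw [Ne, dotProduct_self_eq_zero, sub_eq_zero]
    exact hue
  refine ⟨householder e * householder (u - e), ?_, ?_, Or.inr ?_⟩
  · rw [transpose_mul, Matrix.mul_assoc, ← Matrix.mul_assoc _ (householder e),
      householder_transpose_mul_self he, Matrix.one_mul, householder_transpose_mul_self hv]
  · rw [det_mul, det_householder he, det_householder hv]
    norm_num
  · have h1 : householder (u - e) *ᵥ u = e := by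
      have : 2 / ((u - e) ⬝ᵥ (u - e)) * ((u - e) ⬝ᵥ u) = 1 := by
        rw [div_mul_eq_mul_div, div_eq_one_iff_eq hv]
        simp only [sub_dotProduct, dotProduct_sub, dotProduct_comm e u]
        linarith
      rw [householder_mulVec, this]
      simp
    rw [← mulVec_mulVec, h1, householder_mulVec, div_mul_cancel₀ _ he, two_smul]
    simp

lemma IsMotionInvariant.measure_separatingSet_eq {d : ℕ} {ν : Measure (Fin d → ℝ)}
    (hν : IsMotionInvariant ν) (hfin : ∀ q, ν (separatingSet q) ≠ ⊤) {e : Fin d → ℝ}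
    (he : e ⬝ᵥ e = 1) (q : Fin d → ℝ) :
    ν (separatingSet q) = ENNReal.ofReal (Real.sqrt (q ⬝ᵥ q)) * ν (separatingSet e) := by
  have hq : 0 ≤ q ⬝ᵥ q := by
    simpa [dotProduct] using Finset.sum_nonneg fun i _ => mul_self_nonneg (q i)
  rw [← hν.measure_separatingSet_smul hfin (Real.sqrt_nonneg _)]
  obtain ⟨M, hM, hdet, h | h⟩ := exists_rotation_mulVec_eq_or_eq_neg
    (u := q) (e := Real.sqrt (q ⬝ᵥ q) • e)
    (by simp [smul_dotProduct, dotProduct_smul, he, Real.mul_self_sqrt hq])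
  · rw [← h, hν.measure_separatingSet_mulVec hM hdet]
  · rw [← hν.measure_separatingSet_neg (_ • e), ← h, hν.measure_separatingSet_mulVec hM hdet]

/-- Motion invariant measures on hyperplanes which agree on the set of hyperplanes meeting the
unit ball are equal. -/
lemma IsMotionInvariant.restrict_compl_zero_eq {d : ℕ} (hd : 1 ≤ d) {μ ν : Measure (Fin d → ℝ)}
    (hμ : IsMotionInvariant μ) (hν : IsMotionInvariant ν)
    (h : μ {η | 1 ≤ η ⬝ᵥ η} = ν {η | 1 ≤ η ⬝ᵥ η}) (h0 : μ {η | 1 ≤ η ⬝ᵥ η} ≠ 0)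
    (htop : μ {η | 1 ≤ η ⬝ᵥ η} ≠ ⊤) :
    μ.restrict {0}ᶜ = ν.restrict {0}ᶜ := by
  have hμfin := hμ.measure_separatingSet_ne_top htop
  have hνfin := hν.measure_separatingSet_ne_top (h ▸ htop)
  obtain ⟨e, he⟩ : ∃ e : Fin d → ℝ, e ⬝ᵥ e = 1 := ⟨Pi.single ⟨0, hd⟩ 1, by simp⟩
  have hμe := hμ.measure_separatingSet_eq hμfin he
  have hνe := hν.measure_separatingSet_eq hνfin he
  have hscaled : (ν (separatingSet e) • μ).restrict {0}ᶜ
      = (μ (separatingSet e) • ν).restrict {0}ᶜ := by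
    refine restrict_compl_zero_eq_of_symmDiff ?_ ?_ ?_ ?_
    · intro p q
      simp [hμ.measure_symmDiff_separatingSet]
    · intro p q
      simp [hν.measure_symmDiff_separatingSet]
    · intro q
      simpa using ENNReal.mul_ne_top (hνfin e) (hμfin q)
    · intro q
      simp only [Measure.smul_apply, smul_eq_mul]
      rw [hμe q, hνe q]
      ring
  have hsub : {η : Fin d → ℝ | 1 ≤ η ⬝ᵥ η} ⊆ {0}ᶜ := by
    rintro η hη rfl
    simp [not_le.2 (zero_lt_one (α := ℝ))] at hη
  have heq : ν (separatingSet e) = μ (separatingSet e) := by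
    have := congrArg (fun κ => κ {η : Fin d → ℝ | 1 ≤ η ⬝ᵥ η}) hscaled
    simp only [Measure.restrict_apply' (measurableSet_singleton (0 : Fin d → ℝ)).compl,
      Set.inter_eq_left.2 hsub, Measure.smul_apply, smul_eq_mul, ← h] at this
    exact (ENNReal.mul_left_inj h0 htop).1 this
  refine restrict_compl_zero_eq_of_symmDiff hμ.measure_symmDiff_separatingSet
    hν.measure_symmDiff_separatingSet hμfin fun q => ?_
  rw [hμe, hνe, heq]

lemma measurable_hyperplaneTranslation {d : ℕ} (b : Fin d → ℝ) :
    Measurable (hyperplaneTranslation b) := by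
  unfold hyperplaneTranslation
  simp only [dotProduct]
  fun_prop

lemma hyperplaneTranslation_factor {d : ℕ} (b η : Fin d → ℝ) (h : 1 + b ⬝ᵥ η ≠ 0) :
    1 + (-b) ⬝ᵥ hyperplaneTranslation b η = (1 + b ⬝ᵥ η)⁻¹ := by
  rw [hyperplaneTranslation, neg_dotProduct, dotProduct_smul, smul_eq_mul]
  field_simp
  ring

lemma hyperplaneTranslation_neg_apply {d : ℕ} (b η : Fin d → ℝ) (h : 1 + b ⬝ᵥ η ≠ 0) :
    hyperplaneTranslation (-b) (hyperplaneTranslation b η) = η := by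
  rw [hyperplaneTranslation, hyperplaneTranslation_factor b η h, inv_inv, hyperplaneTranslation,
    smul_smul, mul_inv_cancel₀ h, one_smul]

/-- The Jacobian matrix of `hyperplaneTranslation b` at `η`. -/
noncomputable def hyperplaneTranslationJacobian {d : ℕ} (b η : Fin d → ℝ) :
    Matrix (Fin d) (Fin d) ℝ :=
  (1 + b ⬝ᵥ η)⁻¹ • (1 - (1 + b ⬝ᵥ η)⁻¹ • vecMulVec η b)

lemma hasFDerivAt_hyperplaneTranslation {d : ℕ} (b η : Fin d → ℝ) (h : 1 + b ⬝ᵥ η ≠ 0) :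
    HasFDerivAt (hyperplaneTranslation b)
      (LinearMap.toContinuousLinearMap (hyperplaneTranslationJacobian b η).mulVecLin) η := by
  let L : (Fin d → ℝ) →L[ℝ] ℝ :=
    LinearMap.toContinuousLinearMap (dotProductBilin ℝ ℝ b)
  have hL : HasFDerivAt (fun η : Fin d → ℝ => 1 + b ⬝ᵥ η) L η :=
    (L.hasFDerivAt (x := η)).const_add 1
  have hinv := (hasDerivAt_inv h).comp_hasFDerivAt η hL
  have hmul := hinv.smul (hasFDerivAt_id η)
  refine hmul.congr_fderiv ?_
  ext v i
  simp [L, hyperplaneTranslationJacobian, vecMulVec_mulVec]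
  field_simp
  ring

lemma det_hyperplaneTranslationJacobian {d : ℕ} (b η : Fin d → ℝ) (h : 1 + b ⬝ᵥ η ≠ 0) :
    (LinearMap.toContinuousLinearMap (hyperplaneTranslationJacobian b η).mulVecLin).det
      = (1 + b ⬝ᵥ η)⁻¹ ^ (d + 1) := by
  rw [ContinuousLinearMap.det, LinearMap.coe_toContinuousLinearMap, ← toLin'_apply',
    LinearMap.det_toLin', hyperplaneTranslationJacobian, det_smul, det_one_sub_smul_vecMulVec,
    Fintype.card_fin, pow_succ]
  field_simp
  ring

lemma volume_dotProduct_eq_one {d : ℕ} (q : Fin d → ℝ) :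
    volume {η : Fin d → ℝ | η ⬝ᵥ q = 1} = 0 := by
  let s : AffineSubspace ℝ (Fin d → ℝ) :=
    (AffineSubspace.mk' (1 : ℝ) ⊥).comap (dotProductBilin ℝ ℝ q).toAffineMap
  have hs : (s : Set (Fin d → ℝ)) = {η | η ⬝ᵥ q = 1} := by
    ext η
    simp [s, AffineSubspace.mem_mk', sub_eq_zero, dotProduct_comm]
  rw [← hs]
  refine Measure.addHaar_affineSubspace _ _ fun htop => ?_
  have h0 : (0 : Fin d → ℝ) ∈ s := htop ▸ AffineSubspace.mem_top ..
  rw [← SetLike.mem_coe, hs] at h0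
  simp at h0

/-- The measure `C ‖η‖ ^ (-(1 + d)) dη`, where `‖η‖` is the Euclidean norm. -/
noncomputable def cartesianHyperplaneMeasure (d : ℕ) (C : ℝ) : Measure (Fin d → ℝ) :=
  volume.withDensity fun η => ENNReal.ofReal (C * Real.sqrt (∑ i, η i ^ 2) ^ (-(1 + (d : ℝ))))

lemma measurable_cartesianDensity (d : ℕ) (C : ℝ) : Measurable fun η : Fin d → ℝ =>
    ENNReal.ofReal (C * Real.sqrt (∑ i, η i ^ 2) ^ (-(1 + (d : ℝ)))) := by
  fun_prop

lemma cartesianHyperplaneMeasure_null {d : ℕ} (C : ℝ) (q : Fin d → ℝ) :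
    cartesianHyperplaneMeasure d C {η | η ⬝ᵥ q = 1} = 0 :=
  withDensity_absolutelyContinuous _ _ (volume_dotProduct_eq_one q)

lemma sqrt_sum_sq_smul {d : ℕ} (c : ℝ) (η : Fin d → ℝ) :
    Real.sqrt (∑ i, (c • η) i ^ 2) = |c| * Real.sqrt (∑ i, η i ^ 2) := by
  simp only [Pi.smul_apply, smul_eq_mul, mul_pow, ← Finset.mul_sum]
  rw [Real.sqrt_mul (sq_nonneg c), Real.sqrt_sq_eq_abs]

lemma measurePreserving_hyperplaneTranslation {d : ℕ} {C : ℝ} (b : Fin d → ℝ) :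
    MeasurePreserving (hyperplaneTranslation b) (cartesianHyperplaneMeasure d C)
      (cartesianHyperplaneMeasure d C) := by
  refine ⟨measurable_hyperplaneTranslation b, ?_⟩
  ext B hB
  rw [Measure.map_apply (measurable_hyperplaneTranslation b) hB]
  set A := hyperplaneTranslation b ⁻¹' B with hA
  have hAm : MeasurableSet A := measurable_hyperplaneTranslation b hB
  have hset (b : Fin d → ℝ) : MeasurableSet {η : Fin d → ℝ | 1 + b ⬝ᵥ η ≠ 0} := by
    have : Measurable fun η : Fin d → ℝ => 1 + b ⬝ᵥ η := by
      simp only [dotProduct]; fun_prop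
    exact (measurableSet_eq_fun this measurable_const).compl
  have hdiff (b : Fin d → ℝ) (s : Set (Fin d → ℝ)) : cartesianHyperplaneMeasure d C s =
      cartesianHyperplaneMeasure d C (s ∩ {η | 1 + b ⬝ᵥ η ≠ 0}) := by
    refine (measure_inter_conull' (measure_mono_null ?_
      (cartesianHyperplaneMeasure_null C (-b)))).symm
    rintro η ⟨-, hη⟩
    simp only [Set.mem_ofPred_eq, not_not] at hη
    rw [Set.mem_ofPred_eq, dotProduct_neg, dotProduct_comm]
    linarith
  have himage : hyperplaneTranslation b '' (A ∩ {η | 1 + b ⬝ᵥ η ≠ 0})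
      = B ∩ {η | 1 + (-b) ⬝ᵥ η ≠ 0} := by
    ext ξ
    constructor
    · rintro ⟨η, ⟨hη, hs⟩, rfl⟩
      refine ⟨hη, ?_⟩
      rw [Set.mem_ofPred_eq, hyperplaneTranslation_factor b η hs]
      exact inv_ne_zero hs
    · rintro ⟨hξ, hs⟩
      have h1 := hyperplaneTranslation_neg_apply (-b) ξ hs
      have h2 := hyperplaneTranslation_factor (-b) ξ hs
      rw [neg_neg] at h1 h2
      refine ⟨hyperplaneTranslation (-b) ξ, ⟨?_, ?_⟩, h1⟩
      · rwa [hA, Set.mem_preimage, h1]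
      · rw [Set.mem_ofPred_eq, h2]
        exact inv_ne_zero hs
  rw [hdiff b, hdiff (-b) B, ← himage]
  have hm := hAm.inter (hset b)
  have hinj : Set.InjOn (hyperplaneTranslation b) (A ∩ {η | 1 + b ⬝ᵥ η ≠ 0}) :=
    Set.LeftInvOn.injOn (f₁' := hyperplaneTranslation (-b))
      fun η hη => hyperplaneTranslation_neg_apply b η hη.2
  have hmi : MeasurableSet (hyperplaneTranslation b '' (A ∩ {η | 1 + b ⬝ᵥ η ≠ 0})) :=
    himage ▸ hB.inter (hset (-b))
  rw [cartesianHyperplaneMeasure, withDensity_apply _ hm, withDensity_apply _ hmi,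
    lintegral_image_eq_lintegral_abs_det_fderiv_mul volume hm
      (fun η hη => (hasFDerivAt_hyperplaneTranslation b η hη.2).hasFDerivWithinAt) hinj]
  refine setLIntegral_congr_fun hm fun η hη => ?_
  have hs : 1 + b ⬝ᵥ η ≠ 0 := hη.2
  have hs' : 0 < |(1 + b ⬝ᵥ η)⁻¹| := abs_pos.2 (inv_ne_zero hs)
  beta_reduce
  rw [det_hyperplaneTranslationJacobian b η hs, ← ENNReal.ofReal_mul (abs_nonneg _),
    hyperplaneTranslation, sqrt_sum_sq_smul, Real.mul_rpow hs'.le (Real.sqrt_nonneg _), abs_pow,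
    Real.rpow_neg hs'.le, ← Nat.cast_one, ← Nat.cast_add, Real.rpow_natCast, add_comm 1 d]
  congr 1
  field_simp

lemma dotProduct_self_mulVec {d : ℕ} {M : Matrix (Fin d) (Fin d) ℝ} (hM : Mᵀ * M = 1)
    (η : Fin d → ℝ) : (M *ᵥ η) ⬝ᵥ (M *ᵥ η) = η ⬝ᵥ η := by
  rw [dotProduct_mulVec, ← mulVec_transpose, mulVec_mulVec, hM, one_mulVec]

lemma measurePreserving_mulVec_cartesianHyperplaneMeasure {d : ℕ} {C : ℝ}
    {M : Matrix (Fin d) (Fin d) ℝ} (hM : Mᵀ * M = 1) (hdet : M.det = 1) :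
    MeasurePreserving M.mulVec (cartesianHyperplaneMeasure d C)
      (cartesianHyperplaneMeasure d C) := by
  have hmeas : Measurable M.mulVec := M.mulVecLin.continuous_of_finiteDimensional.measurable
  have hvol : MeasurePreserving M.mulVec (volume : Measure (Fin d → ℝ)) volume := by
    refine ⟨hmeas, ?_⟩
    have := Real.map_matrix_volume_pi_eq_smul_volume_pi (M := M) (by rw [hdet]; norm_num)
    simpa [hdet, funext (toLin'_apply M)] using this
  refine ⟨hmeas, ?_⟩
  ext B hB
  rw [Measure.map_apply hmeas hB, cartesianHyperplaneMeasure, withDensity_apply _ hB,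
    withDensity_apply _ (hmeas hB),
    ← hvol.setLIntegral_comp_preimage hB (measurable_cartesianDensity d C)]
  refine setLIntegral_congr_fun (hmeas hB) fun η _ => ?_
  have h := dotProduct_self_mulVec hM η
  simp only [dotProduct, ← sq] at h
  rw [h]

lemma isMotionInvariant_cartesianHyperplaneMeasure (d : ℕ) (C : ℝ) :
    IsMotionInvariant (cartesianHyperplaneMeasure d C) where
  null := cartesianHyperplaneMeasure_null C
  translation := measurePreserving_hyperplaneTranslation
  rotation _ := measurePreserving_mulVec_cartesianHyperplaneMeasure

lemma cartesianHyperplaneMeasure_outside_ball {d : ℕ} (hd : 1 ≤ d) {C : ℝ} (hC : 0 ≤ C) :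
    cartesianHyperplaneMeasure d C {η | 1 ≤ η ⬝ᵥ η} = ENNReal.ofReal
      (d * (Real.sqrt Real.pi ^ d / Real.Gamma ((d : ℝ) / 2 + 1)) * C) := by
  have : Nonempty (Fin d) := ⟨⟨0, hd⟩⟩
  let f : ℝ → ℝ := (Set.Ici 1).indicator fun r => C * r ^ (-(1 + (d : ℝ)))
  have hf0 (r : ℝ) : 0 ≤ f r := by
    refine Set.indicator_nonneg (fun r hr => ?_) r
    have : 0 ≤ r := zero_le_one.trans hr
    positivity
  have hmeas : MeasurableSet {η : Fin d → ℝ | 1 ≤ η ⬝ᵥ η} := by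
    have : Measurable fun η : Fin d → ℝ => η ⬝ᵥ η := by
      simp only [dotProduct]; fun_prop
    exact measurableSet_le measurable_const this
  have hpow : Set.EqOn (fun y : ℝ => y ^ (d - 1) • f y)
      ((Set.Ici 1).indicator fun y => C * y ^ (-2 : ℝ)) (Set.Ioi 0) := by
    intro y hy
    have hy' : 0 < y := hy
    by_cases h1 : y ∈ Set.Ici (1 : ℝ)
    · simp only [f, Set.indicator_of_mem h1, smul_eq_mul]
      rw [← Real.rpow_natCast, mul_left_comm, ← Real.rpow_add hy', Nat.cast_sub hd]
      congr 2
      push_cast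
      ring
    · simp [f, Set.indicator_of_notMem h1]
  have hsub : Set.Ici (1 : ℝ) ⊆ Set.Ioi 0 := Set.Ici_subset_Ioi.2 zero_lt_one
  have hint : Integrable (fun x : EuclideanSpace ℝ (Fin d) => f ‖x‖) := by
    rw [integrable_fun_norm_addHaar, finrank_euclideanSpace_fin,
      integrableOn_congr_fun hpow measurableSet_Ioi, IntegrableOn,
      integrable_indicator_iff measurableSet_Ici, IntegrableOn,
      Measure.restrict_restrict measurableSet_Ici, Set.inter_eq_left.2 hsub]
    refine Integrable.const_mul ?_ C
    rw [← IntegrableOn, integrableOn_Ici_iff_integrableOn_Ioi]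
    exact integrableOn_Ioi_rpow_of_lt (by norm_num) zero_lt_one
  have hval : ∫ y in Set.Ioi (0 : ℝ), y ^ (d - 1) • f y = C := by
    rw [setIntegral_congr_fun measurableSet_Ioi hpow, setIntegral_indicator measurableSet_Ici,
      Set.inter_eq_right.2 hsub, integral_const_mul, integral_Ici_eq_integral_Ioi,
      integral_Ioi_rpow_of_lt (by norm_num) zero_lt_one]
    norm_num
  have hball : (volume : Measure (EuclideanSpace ℝ (Fin d))).real (Metric.ball 0 1)
      = Real.sqrt Real.pi ^ d / Real.Gamma ((d : ℝ) / 2 + 1) := by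
    rw [measureReal_def, EuclideanSpace.volume_ball, Fintype.card_fin]
    have : 0 ≤ Real.sqrt Real.pi ^ d / Real.Gamma ((d : ℝ) / 2 + 1) := by
      have : 0 < Real.Gamma ((d : ℝ) / 2 + 1) := Real.Gamma_pos_of_pos (by positivity)
      positivity
    simp [ENNReal.toReal_ofReal this]
  have hint_val := integral_fun_norm_addHaar (volume : Measure (EuclideanSpace ℝ (Fin d))) f
  rw [finrank_euclideanSpace_fin, hval, hball, nsmul_eq_mul, smul_eq_mul, ← mul_assoc] at hint_val
  rw [cartesianHyperplaneMeasure, withDensity_apply _ hmeas, ← lintegral_indicator hmeas,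
    ← hint_val, ofReal_integral_eq_lintegral_ofReal hint (.of_forall fun x => hf0 _),
    ← (PiLp.volume_preserving_ofLp (Fin d)).lintegral_comp
      ((measurable_cartesianDensity d C).indicator hmeas)]
  refine lintegral_congr fun x => ?_
  have hn : ‖x‖ = Real.sqrt (∑ i, x.ofLp i ^ 2) := by
    simp [EuclideanSpace.norm_eq]
  have hmem : x.ofLp ∈ {η : Fin d → ℝ | 1 ≤ η ⬝ᵥ η} ↔ ‖x‖ ∈ Set.Ici (1 : ℝ) := by
    rw [Set.mem_ofPred_eq, Set.mem_Ici, hn, Real.one_le_sqrt]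
    simp only [dotProduct, sq]
  by_cases hx : ‖x‖ ∈ Set.Ici (1 : ℝ)
  · rw [Set.indicator_of_mem (hmem.2 hx)]
    simp only [f, Set.indicator_of_mem hx]
    rw [hn]
  · rw [Set.indicator_of_notMem (mt hmem.1 hx)]
    simp only [f, Set.indicator_of_notMem hx, ENNReal.ofReal_zero]

lemma setOf_meets_unitBall_eq {d : ℕ} :
    {η : Fin d → ℝ | ∃ x : Fin d → ℝ, (∑ i, x i ^ 2) ≤ 1 ∧ η ⬝ᵥ x = 1} = {η | 1 ≤ η ⬝ᵥ η} := by
  ext η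
  simp only [Set.mem_ofPred_eq]
  have h0 : 0 ≤ η ⬝ᵥ η := by
    simpa [dotProduct] using Finset.sum_nonneg fun i _ => mul_self_nonneg (η i)
  constructor
  · rintro ⟨x, hx, h⟩
    have hcs : (η ⬝ᵥ x) ^ 2 ≤ (η ⬝ᵥ η) * ∑ i, x i ^ 2 := by
      simpa [dotProduct, sq] using Finset.sum_mul_sq_le_sq_mul_sq Finset.univ η x
    rw [h] at hcs
    nlinarith
  · intro h
    have hpos : 0 < η ⬝ᵥ η := zero_lt_one.trans_le h
    refine ⟨(η ⬝ᵥ η)⁻¹ • η, ?_, ?_⟩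
    · have : ∑ i, ((η ⬝ᵥ η)⁻¹ • η) i ^ 2 = (η ⬝ᵥ η)⁻¹ := by
        calc ∑ i, ((η ⬝ᵥ η)⁻¹ • η) i ^ 2
            = ((η ⬝ᵥ η)⁻¹ • η) ⬝ᵥ ((η ⬝ᵥ η)⁻¹ • η) := by simp only [dotProduct, sq]
          _ = (η ⬝ᵥ η)⁻¹ := by
            rw [smul_dotProduct, dotProduct_smul, smul_eq_mul, smul_eq_mul,
              inv_mul_cancel₀ hpos.ne', mul_one]
      rw [this]
      exact inv_le_one_of_one_le₀ h
    · rw [dotProduct_smul, smul_eq_mul, inv_mul_cancel₀ hpos.ne']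

lemma isMotionInvariant_of_map_eq {d : ℕ} {μ : Measure (Fin d → ℝ)} [SigmaFinite μ]
    (hinv : ∀ M : Matrix (Fin d) (Fin d) ℝ, Mᵀ * M = 1 → M.det = 1 → ∀ b : Fin d → ℝ,
      μ.map (fun η : Fin d → ℝ => (1 + b ⬝ᵥ M.mulVec η)⁻¹ • M.mulVec η) = μ) :
    IsMotionInvariant μ := by
  have htrans (b : Fin d → ℝ) : MeasurePreserving (hyperplaneTranslation b) μ μ := by
    refine ⟨measurable_hyperplaneTranslation b, ?_⟩
    have h := hinv 1 (by simp) (by simp) b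
    simp only [one_mulVec] at h
    exact h
  refine ⟨fun q => ?_, htrans, fun M hM hdet => ?_⟩
  · have h0 := (htrans (-q)).measure_preimage (measurableSet_singleton 0).nullMeasurableSet
    have hfin : μ {0} ≠ ⊤ :=
      measure_ne_top_of_subset (Set.singleton_subset_iff.2 (mem_spanningSetsIndex μ 0))
        (measure_spanningSets_lt_top μ _).ne
    have hsub : {η | η ⬝ᵥ q = 1} ∪ {0} ⊆ hyperplaneTranslation (-q) ⁻¹' {0} := by
      rintro η (hη | hη)
      · rw [Set.mem_ofPred_eq] at hη
        simp [hyperplaneTranslation, dotProduct_comm q, hη]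
      · rw [Set.mem_singleton_iff] at hη
        simp [hyperplaneTranslation, hη]
    have hdisj : Disjoint {η | η ⬝ᵥ q = 1} ({0} : Set (Fin d → ℝ)) := by
      rw [Set.disjoint_singleton_right]
      simp
    have hle := measure_mono (μ := μ) hsub
    rw [measure_union hdisj (measurableSet_singleton 0), h0] at hle
    exact le_antisymm (ENNReal.le_of_add_le_add_right hfin (by simpa using hle)) (by simp)
  · refine ⟨M.mulVecLin.continuous_of_finiteDimensional.measurable, ?_⟩
    simpa using hinv M hM hdet 0

/-- Cartesian parametrization of affine hyperplanes: identifying a hyperplane not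
through the origin with its vector `η` (via `x ∈ σ ⟺ ηᵀx = 1`), rigid motions
`x ↦ Mx + b` (`M ∈ SO(d)`) act by `η ↦ Mη/(1 + bᵀMη)`.  If `μ` is a (σ-finite) measure
invariant under all these actions and normalized so that the set of hyperplanes meeting
the unit ball has measure 2, then `μ`, restricted away from `η = 0`, has density
`(2/ω_d)‖η‖^{-(1+d)}` with respect to Lebesgue measure, where `ω_d = 2π^{d/2}/Γ(d/2)`
is the surface area of the unit sphere. -/
theorem stmt_15 (d : ℕ) (hd : 1 ≤ d) (μ : Measure (Fin d → ℝ)) [SigmaFinite μ]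
    (hinv : ∀ M : Matrix (Fin d) (Fin d) ℝ, Mᵀ * M = 1 → M.det = 1 → ∀ b : Fin d → ℝ,
      μ.map (fun η : Fin d → ℝ => (1 + b ⬝ᵥ M.mulVec η)⁻¹ • M.mulVec η) = μ)
    (hnorm : μ {η : Fin d → ℝ |
      ∃ x : Fin d → ℝ, (∑ i, x i ^ 2) ≤ 1 ∧ η ⬝ᵥ x = 1} = 2) :
    μ.restrict {(0 : Fin d → ℝ)}ᶜ
      = volume.withDensity (fun η : Fin d → ℝ =>
          ENNReal.ofReal ((2 / (2 * Real.pi ^ ((d:ℝ)/2) / Real.Gamma ((d:ℝ)/2))) *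
            Real.sqrt (∑ i, η i ^ 2) ^ (-(1 + (d:ℝ))))) := by
  have hd' : (0 : ℝ) < d := by exact_mod_cast hd
  have hΓ : 0 < Real.Gamma ((d : ℝ) / 2) := Real.Gamma_pos_of_pos (by positivity)
  have hπ : 0 < Real.pi ^ ((d : ℝ) / 2) := Real.rpow_pos_of_pos Real.pi_pos _
  set C := 2 / (2 * Real.pi ^ ((d : ℝ) / 2) / Real.Gamma ((d : ℝ) / 2)) with hC
  have hC0 : 0 ≤ C := by positivity
  have hmass : cartesianHyperplaneMeasure d C {η | 1 ≤ η ⬝ᵥ η} = 2 := by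
    rw [cartesianHyperplaneMeasure_outside_ball hd hC0, Real.Gamma_add_one (by positivity),
      Real.sqrt_eq_rpow, ← Real.rpow_natCast, ← Real.rpow_mul Real.pi_pos.le,
      show (1 / 2 : ℝ) * (d : ℝ) = (d : ℝ) / 2 by ring, hC, ← ENNReal.ofReal_ofNat]
    congr 1
    field_simp
  rw [setOf_meets_unitBall_eq] at hnorm
  rw [(isMotionInvariant_of_map_eq hinv).restrict_compl_zero_eq hd
    (isMotionInvariant_cartesianHyperplaneMeasure d C) (by rw [hnorm, hmass])
    (by rw [hnorm]; norm_num) (by rw [hnorm]; norm_num)]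
  have : Nonempty (Fin d) := ⟨⟨0, hd⟩⟩
  refine Measure.restrict_eq_self_of_ae_mem ?_
  have hzero : cartesianHyperplaneMeasure d C {0} = 0 :=
    withDensity_absolutelyContinuous _ _ (measure_singleton 0)
  simpa [ae_iff] using hzero
end

section
/- For the canonical simplex 𝕋₃ and a,b,c > 1 pairwise distinct, ∫_{𝕋₃} |ηᵀx − 1|^k dλ₃ = (1/((k+1)(k+2)(k+3)))·(1/(abc) + (a−1)^{k+3}/(a(a−b)(a−c)) + (b−1)^{k+3}/(b(b−a)(b−c)) + (c−1)^{k+3}/(c(c−a)(c−b))) for every odd positive integer k. -/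
open MeasureTheory

/-- `t ↦ |t| tⁿ⁺¹` is differentiable everywhere, also at the origin. -/
lemma hasDerivAt_abs_mul_pow (n : ℕ) (t : ℝ) :
    HasDerivAt (fun s : ℝ => |s| * s ^ (n + 1)) ((n + 2) * (|t| * t ^ n)) t := by
  induction n with
  | zero =>
    rcases lt_trichotomy t 0 with ht | rfl | ht
    · refine ((hasDerivAt_abs_neg ht).fun_mul (hasDerivAt_pow 1 t)).congr_deriv ?_
      rw [abs_of_neg ht]; push_cast; ring
    · rw [hasDerivAt_iff_tendsto_slope]
      have h : Filter.Tendsto (fun s : ℝ => |s|) (nhdsWithin 0 {0}ᶜ) (nhds 0) := by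
        simpa using (continuous_abs.tendsto (0 : ℝ)).mono_left nhdsWithin_le_nhds
      simp only [abs_zero, zero_mul, mul_zero]
      refine h.congr' ?_
      filter_upwards [self_mem_nhdsWithin] with s hs
      have hs : s ≠ 0 := hs
      simp only [slope_def_field]
      field_simp
      simp
    · refine ((hasDerivAt_abs_pos ht).fun_mul (hasDerivAt_pow 1 t)).congr_deriv ?_
      rw [abs_of_pos ht]; push_cast; ring
  | succ n ih =>
    simp only [pow_succ _ (n + 1), ← mul_assoc]
    refine (ih.fun_mul (hasDerivAt_id' t)).congr_deriv ?_
    push_cast; ring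

lemma integral_comp_affine {F f : ℝ → ℝ} (hF : ∀ t, HasDerivAt F (f t) t) (hf : Continuous f)
    {p : ℝ} (hp : p ≠ 0) (q u v : ℝ) :
    ∫ x in u..v, f (p * x + q) = (F (p * v + q) - F (p * u + q)) / p := by
  rw [intervalIntegral.integral_comp_mul_add f hp q,
    intervalIntegral.integral_eq_sub_of_hasDerivAt (fun t _ => hF t)
      (hf.intervalIntegrable _ _), smul_eq_mul]
  ring

lemma convexHull_zero_single_eq :
    convexHull ℝ ({0, EuclideanSpace.single 0 1, EuclideanSpace.single 1 1,
        EuclideanSpace.single 2 1} : Set (EuclideanSpace ℝ (Fin 3)))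
      = {x | 0 ≤ x 0 ∧ 0 ≤ x 1 ∧ 0 ≤ x 2 ∧ x 0 + x 1 + x 2 ≤ 1} := by
  apply Set.Subset.antisymm
  · apply convexHull_min
    · rintro x (rfl | rfl | rfl | rfl) <;> simp
    · rintro x ⟨h0, h1, h2, h3⟩ y ⟨g0, g1, g2, g3⟩ s t hs ht hst
      simp only [Set.mem_ofPred_eq, PiLp.add_apply, PiLp.smul_apply, smul_eq_mul]
      refine ⟨by positivity, by positivity, by positivity, ?_⟩
      nlinarith
  · rintro x ⟨h0, h1, h2, h3⟩
    set V : Set (EuclideanSpace ℝ (Fin 3)) := {0, EuclideanSpace.single 0 1,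
      EuclideanSpace.single 1 1, EuclideanSpace.single 2 1} with hV
    have key := (convex_convexHull ℝ V).sum_mem (t := Finset.univ)
      (w := ![1 - x 0 - x 1 - x 2, x 0, x 1, x 2])
      (z := ![0, EuclideanSpace.single 0 1, EuclideanSpace.single 1 1,
        EuclideanSpace.single 2 1])
      (by
        intro i _
        fin_cases i <;> simp <;> linarith)
      (by simp [Fin.sum_univ_four]; ring)
      (by
        intro i _
        apply subset_convexHull
        fin_cases i <;> simp [hV])
    convert key using 1
    ext i
    fin_cases i <;> simp [Fin.sum_univ_four]

lemma setIntegral_prod_slices {β : Type*} [MeasureSpace β] [SFinite (volume : Measure β)]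
    {s : Set ℝ} {S : ℝ → Set β} {g : ℝ × β → ℝ} (hs : MeasurableSet s)
    (hS : ∀ x, MeasurableSet (S x))
    (hm : MeasurableSet {p : ℝ × β | p.1 ∈ s ∧ p.2 ∈ S p.1})
    (hg : IntegrableOn g {p : ℝ × β | p.1 ∈ s ∧ p.2 ∈ S p.1}) :
    ∫ p in {p : ℝ × β | p.1 ∈ s ∧ p.2 ∈ S p.1}, g p
      = ∫ x in s, ∫ y in S x, g (x, y) := by
  classical
  rw [← integral_indicator hm, ← integral_indicator hs, Measure.volume_eq_prod,
    integral_prod]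
  · congr 1
    funext x
    by_cases hx : x ∈ s
    · rw [Set.indicator_of_mem hx, ← integral_indicator (hS x)]
      congr 1
      funext y
      simp [Set.indicator_apply, hx]
    · simp [hx]
  · rw [← Measure.volume_eq_prod]
    exact hg.integrable_indicator hm

/-- The triangle `{y, z ≥ 0, y + z ≤ r}` is integrated over by iterated interval integrals. -/
lemma setIntegral_triangle {r : ℝ} (hr : 0 ≤ r) {g : ℝ × ℝ → ℝ} (hg : Continuous g) :
    ∫ p in {p : ℝ × ℝ | 0 ≤ p.1 ∧ 0 ≤ p.2 ∧ p.1 + p.2 ≤ r}, g p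
      = ∫ y in (0 : ℝ)..r, ∫ z in (0 : ℝ)..(r - y), g (y, z) := by
  have hset : {p : ℝ × ℝ | 0 ≤ p.1 ∧ 0 ≤ p.2 ∧ p.1 + p.2 ≤ r}
      = {p : ℝ × ℝ | p.1 ∈ Set.Icc 0 r ∧ p.2 ∈ Set.Icc 0 (r - p.1)} := by
    ext p
    simp only [Set.mem_ofPred_eq, Set.mem_Icc]
    constructor
    · rintro ⟨h1, h2, h3⟩; exact ⟨⟨h1, by linarith⟩, h2, by linarith⟩
    · rintro ⟨⟨h1, h2⟩, h3, h4⟩; exact ⟨h1, h3, by linarith⟩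
  have hcl : IsClosed {p : ℝ × ℝ | 0 ≤ p.1 ∧ 0 ≤ p.2 ∧ p.1 + p.2 ≤ r} :=
    (isClosed_le (by fun_prop) (by fun_prop)).and <|
      (isClosed_le (by fun_prop) (by fun_prop)).and <|
        isClosed_le (by fun_prop) (by fun_prop)
  have hco : IsCompact {p : ℝ × ℝ | 0 ≤ p.1 ∧ 0 ≤ p.2 ∧ p.1 + p.2 ≤ r} := by
    refine (isCompact_Icc (a := ((0, 0) : ℝ × ℝ)) (b := (r, r))).of_isClosed_subset hcl ?_
    rintro ⟨y, z⟩ ⟨h1, h2, h3⟩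
    dsimp only at h1 h2 h3
    exact ⟨⟨h1, h2⟩, ⟨by dsimp only; linarith, by dsimp only; linarith⟩⟩
  have hi := hg.continuousOn.integrableOn_compact (μ := volume) hco
  have hm := hcl.measurableSet
  rw [hset] at hi hm ⊢
  rw [setIntegral_prod_slices (S := fun y => Set.Icc 0 (r - y)) measurableSet_Icc
    (fun _ => measurableSet_Icc) hm hi, integral_Icc_eq_integral_Ioc,
    intervalIntegral.integral_of_le hr]
  refine setIntegral_congr_fun measurableSet_Ioc fun y hy => ?_
  rw [integral_Icc_eq_integral_Ioc, intervalIntegral.integral_of_le (by linarith [hy.2])]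

lemma setIntegral_tetrahedron {g : ℝ × ℝ × ℝ → ℝ} (hg : Continuous g) :
    ∫ p in {p : ℝ × ℝ × ℝ | 0 ≤ p.1 ∧ 0 ≤ p.2.1 ∧ 0 ≤ p.2.2 ∧ p.1 + p.2.1 + p.2.2 ≤ 1}, g p
      = ∫ x in (0 : ℝ)..1, ∫ y in (0 : ℝ)..(1 - x), ∫ z in (0 : ℝ)..(1 - x - y),
          g (x, y, z) := by
  have hset : {p : ℝ × ℝ × ℝ | 0 ≤ p.1 ∧ 0 ≤ p.2.1 ∧ 0 ≤ p.2.2 ∧ p.1 + p.2.1 + p.2.2 ≤ 1}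
      = {p : ℝ × ℝ × ℝ | p.1 ∈ Set.Icc 0 1 ∧
          p.2 ∈ {q : ℝ × ℝ | 0 ≤ q.1 ∧ 0 ≤ q.2 ∧ q.1 + q.2 ≤ 1 - p.1}} := by
    ext p
    simp only [Set.mem_ofPred_eq, Set.mem_Icc]
    constructor
    · rintro ⟨h1, h2, h3, h4⟩; exact ⟨⟨h1, by linarith⟩, h2, h3, by linarith⟩
    · rintro ⟨⟨h1, h2⟩, h3, h4, h5⟩; exact ⟨h1, h3, h4, by linarith⟩
  have hcl : IsClosed
      {p : ℝ × ℝ × ℝ | 0 ≤ p.1 ∧ 0 ≤ p.2.1 ∧ 0 ≤ p.2.2 ∧ p.1 + p.2.1 + p.2.2 ≤ 1} :=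
    (isClosed_le (by fun_prop) (by fun_prop)).and <|
      (isClosed_le (by fun_prop) (by fun_prop)).and <|
        (isClosed_le (by fun_prop) (by fun_prop)).and <|
          isClosed_le (by fun_prop) (by fun_prop)
  have hco : IsCompact
      {p : ℝ × ℝ × ℝ | 0 ≤ p.1 ∧ 0 ≤ p.2.1 ∧ 0 ≤ p.2.2 ∧ p.1 + p.2.1 + p.2.2 ≤ 1} := by
    refine (isCompact_Icc (a := ((0, 0, 0) : ℝ × ℝ × ℝ))
      (b := (1, 1, 1))).of_isClosed_subset hcl ?_
    rintro ⟨x, y, z⟩ ⟨h1, h2, h3, h4⟩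
    dsimp only at h1 h2 h3 h4
    exact ⟨⟨h1, h2, h3⟩, ⟨by dsimp only; linarith, by dsimp only; linarith,
      by dsimp only; linarith⟩⟩
  have hi := hg.continuousOn.integrableOn_compact (μ := volume) hco
  have hm := hcl.measurableSet
  rw [hset] at hi hm ⊢
  rw [setIntegral_prod_slices
    (S := fun x => {q : ℝ × ℝ | 0 ≤ q.1 ∧ 0 ≤ q.2 ∧ q.1 + q.2 ≤ 1 - x}) measurableSet_Icc
    (fun x => by measurability) hm hi, integral_Icc_eq_integral_Ioc,
    intervalIntegral.integral_of_le zero_le_one]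
  refine setIntegral_congr_fun measurableSet_Ioc fun x hx => ?_
  exact setIntegral_triangle (by linarith [hx.2]) (g := fun q => g (x, q)) (by fun_prop)

lemma volume_preserving_coordinates :
    ∃ e : EuclideanSpace ℝ (Fin 3) ≃ᵐ ℝ × ℝ × ℝ,
      MeasurePreserving e ∧ ∀ x, e x = (x 0, x 1, x 2) := by
  refine ⟨((MeasurableEquiv.toLp 2 (Fin 3 → ℝ)).symm.trans
    (MeasurableEquiv.piFinSuccAbove (fun _ => ℝ) 0)).trans
    ((MeasurableEquiv.refl ℝ).prodCongr MeasurableEquiv.finTwoArrow), ?_, fun x => rfl⟩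
  exact ((MeasurePreserving.id volume).prod (volume_preserving_finTwoArrow ℝ)).comp
    ((volume_preserving_piFinSuccAbove (fun _ : Fin 3 => ℝ) 0).comp
      (PiLp.volume_preserving_ofLp (Fin 3)))

/-- The Hermite–Genocchi formula on the canonical tetrahedron, for the nodes
`d, a + d, b + d, c + d`. -/
lemma integral_simplex_eq_divided_difference {F₀ F₁ F₂ F₃ : ℝ → ℝ}
    (h₁ : ∀ t, HasDerivAt F₁ (F₀ t) t) (h₂ : ∀ t, HasDerivAt F₂ (F₁ t) t)
    (h₃ : ∀ t, HasDerivAt F₃ (F₂ t) t) (h₀ : Continuous F₀) {a b c : ℝ} (d : ℝ)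
    (ha : a ≠ 0) (hb : b ≠ 0) (hc : c ≠ 0) (hab : a ≠ b) (hac : a ≠ c) (hbc : b ≠ c) :
    (∫ x in convexHull ℝ ({0, EuclideanSpace.single 0 1, EuclideanSpace.single 1 1,
        EuclideanSpace.single 2 1} : Set (EuclideanSpace ℝ (Fin 3))),
      F₀ (a * x 0 + b * x 1 + c * x 2 + d))
      = -F₃ d / (a * b * c) + F₃ (a + d) / (a * (a - b) * (a - c))
        + F₃ (b + d) / (b * (b - a) * (b - c)) + F₃ (c + d) / (c * (c - a) * (c - b)) := by
  have hab' := sub_ne_zero.2 hab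
  have hac' := sub_ne_zero.2 hac
  have hbc' := sub_ne_zero.2 hbc
  have c₁ : Continuous F₁ := continuous_iff_continuousAt.2 fun t => (h₁ t).continuousAt
  have c₂ : Continuous F₂ := continuous_iff_continuousAt.2 fun t => (h₂ t).continuousAt
  have hz (x y : ℝ) : ∫ z in (0 : ℝ)..(1 - x - y), F₀ (a * x + b * y + c * z + d)
      = (F₁ ((b - c) * y + (a * x + c * (1 - x) + d)) - F₁ (b * y + (a * x + d))) / c := by
    have := integral_comp_affine h₁ h₀ hc (a * x + b * y + d) 0 (1 - x - y)
    convert this using 3 <;> ring_nf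
  have hy (x : ℝ) : ∫ y in (0 : ℝ)..(1 - x),
        (F₁ ((b - c) * y + (a * x + c * (1 - x) + d)) - F₁ (b * y + (a * x + d))) / c
      = ((F₂ ((a - b) * x + (b + d)) - F₂ ((a - c) * x + (c + d))) / (b - c)
          - (F₂ ((a - b) * x + (b + d)) - F₂ (a * x + d)) / b) / c := by
    rw [intervalIntegral.integral_div, intervalIntegral.integral_sub
      (Continuous.intervalIntegrable (by fun_prop) _ _)
      (Continuous.intervalIntegrable (by fun_prop) _ _),
      integral_comp_affine h₂ c₁ hbc', integral_comp_affine h₂ c₁ hb]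
    ring_nf
  have hx : ∫ x in (0 : ℝ)..1,
        ((F₂ ((a - b) * x + (b + d)) - F₂ ((a - c) * x + (c + d))) / (b - c)
          - (F₂ ((a - b) * x + (b + d)) - F₂ (a * x + d)) / b) / c
      = (((F₃ (a + d) - F₃ (b + d)) / (a - b) - (F₃ (a + d) - F₃ (c + d)) / (a - c)) / (b - c)
          - ((F₃ (a + d) - F₃ (b + d)) / (a - b) - (F₃ (a + d) - F₃ d) / a) / b) / c := by
    have i (p q : ℝ) : IntervalIntegrable (fun x => F₂ (p * x + q)) volume 0 1 :=
      Continuous.intervalIntegrable (by fun_prop) _ _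
    rw [intervalIntegral.integral_div, intervalIntegral.integral_sub
      (((i _ _).sub (i _ _)).div_const _) (((i _ _).sub (i _ _)).div_const _),
      intervalIntegral.integral_div, intervalIntegral.integral_div,
      intervalIntegral.integral_sub (i _ _) (i _ _),
      intervalIntegral.integral_sub (i _ _) (i _ _),
      integral_comp_affine h₃ c₂ hab', integral_comp_affine h₃ c₂ hac',
      integral_comp_affine h₃ c₂ ha]
    ring_nf
  obtain ⟨e, he, hex⟩ := volume_preserving_coordinates
  have ht := he.setIntegral_preimage_emb e.measurableEmbedding
    (fun p : ℝ × ℝ × ℝ => F₀ (a * p.1 + b * p.2.1 + c * p.2.2 + d))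
    {p | 0 ≤ p.1 ∧ 0 ≤ p.2.1 ∧ 0 ≤ p.2.2 ∧ p.1 + p.2.1 + p.2.2 ≤ 1}
  simp only [Set.preimage_ofPred_eq, hex] at ht
  rw [convexHull_zero_single_eq, ht, setIntegral_tetrahedron (by fun_prop)]
  simp only [hz, hy, hx]
  rw [← neg_sub a b, ← neg_sub a c, ← neg_sub b c]
  field_simp
  ring

/-- For the canonical simplex `𝕋₃ = conv(0,e₁,e₂,e₃)` and `a,b,c > 1` pairwise distinct,
for every odd positive integer `k`,
`∫_{𝕋₃} |ηᵀx − 1|^k dλ₃ = (1/((k+1)(k+2)(k+3))) (1/(abc) + (a−1)^{k+3}/(a(a−b)(a−c))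
  + (b−1)^{k+3}/(b(b−a)(b−c)) + (c−1)^{k+3}/(c(c−a)(c−b)))`. -/
theorem stmt_17 (a b c : ℝ) (ha : 1 < a) (hb : 1 < b) (hc : 1 < c)
    (hab : a ≠ b) (hac : a ≠ c) (hbc : b ≠ c)
    (k : ℕ) (hk : Odd k) (hk0 : 0 < k) :
    (∫ x in convexHull ℝ ({0, EuclideanSpace.single 0 1, EuclideanSpace.single 1 1,
        EuclideanSpace.single 2 1} : Set (EuclideanSpace ℝ (Fin 3))),
      |a * x 0 + b * x 1 + c * x 2 - 1| ^ k)
      = (1 / (((k:ℝ) + 1) * ((k:ℝ) + 2) * ((k:ℝ) + 3))) *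
          (1 / (a * b * c) + (a - 1) ^ (k + 3) / (a * (a - b) * (a - c))
            + (b - 1) ^ (k + 3) / (b * (b - a) * (b - c))
            + (c - 1) ^ (k + 3) / (c * (c - a) * (c - b))) := by
  obtain ⟨m, rfl⟩ := hk
  have habs (t : ℝ) : |t| ^ (2 * m + 1) = |t| * t ^ (2 * m) := by
    rw [pow_succ, (even_two_mul m).pow_abs, mul_comm]
  have hder (n : ℕ) (C : ℝ) (t : ℝ) :
      HasDerivAt (fun s : ℝ => |s| * s ^ (n + 1) / (C * (n + 2))) (|t| * t ^ n / C) t := by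
    refine ((hasDerivAt_abs_mul_pow n t).div_const (C * (n + 2))).congr_deriv ?_
    have : (n : ℝ) + 2 ≠ 0 := by positivity
    rw [mul_comm C, mul_div_mul_left _ _ this]
  have key := integral_simplex_eq_divided_difference
    (hder (2 * m) 1) (hder (2 * m + 1) _) (hder (2 * m + 2) _) (by fun_prop) (-1)
    (by positivity : a ≠ 0) (by positivity : b ≠ 0) (by positivity : c ≠ 0) hab hac hbc
  simp only [habs, sub_eq_add_neg _ (1 : ℝ)]
  simp only [div_one] at key
  rw [key, abs_of_pos (by linarith : 0 < a + -1), abs_of_pos (by linarith : 0 < b + -1),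
    abs_of_pos (by linarith : 0 < c + -1), abs_neg, abs_one,
    show (-1 : ℝ) ^ (2 * m + 2 + 1) = -1 from Odd.neg_one_pow ⟨m + 1, by ring⟩]
  push_cast
  simp only [pow_succ, div_eq_mul_inv, mul_inv]
  ring
end

section
/- The expected volume of the simplex spanned by d+1 i.i.d. uniform random points in the d-dimensional unit ball B_d, normalized by vol_d(B_d), equals 2^d Γ((d+1)²/2)² Γ(d+1)^{d+1} / ((d+1)^{d−1} Γ((d+1)²) Γ((d+1)/2)^{2(d+1)}). -/
open MeasureTheory

open Set Matrix in
/-- The corner simplex of side `s` in `ℝⁿ` has volume `sⁿ / n!`. -/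
theorem volume_corner_simplex (n : ℕ) : ∀ s : ℝ, 0 ≤ s →
    volume {x : Fin n → ℝ | (∀ i, 0 ≤ x i) ∧ ∑ i, x i ≤ s} =
      ENNReal.ofReal (s ^ n / n.factorial) := by
  induction n with
  | zero =>
    intro s hs
    have : {x : Fin 0 → ℝ | (∀ i, 0 ≤ x i) ∧ ∑ i, x i ≤ s} = univ := by
      ext x; simpa using hs
    rw [this]
    simp [volume_pi]
  | succ n ih =>
    intro s hs
    have hmeas : MeasurableSet {p : ℝ × (Fin n → ℝ) |
        0 ≤ p.1 ∧ (∀ i, 0 ≤ p.2 i) ∧ p.1 + ∑ i, p.2 i ≤ s} := by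
      apply IsClosed.measurableSet
      simp only [ofPred_and, ofPred_forall]
      refine (isClosed_le (by fun_prop) (by fun_prop)).inter
        ((isClosed_iInter fun i => isClosed_le (by fun_prop) (by fun_prop)).inter
          (isClosed_le (by fun_prop) (by fun_prop)))
    have hpre : {x : Fin (n + 1) → ℝ | (∀ i, 0 ≤ x i) ∧ ∑ i, x i ≤ s} =
        MeasurableEquiv.piFinSuccAbove (fun _ : Fin (n + 1) => ℝ) 0 ⁻¹'
          {p | 0 ≤ p.1 ∧ (∀ i, 0 ≤ p.2 i) ∧ p.1 + ∑ i, p.2 i ≤ s} := by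
      ext x
      simp [MeasurableEquiv.piFinSuccAbove, Fin.forall_fin_succ, Fin.sum_univ_succ,
        Fin.tail, and_assoc]
    rw [hpre, (volume_preserving_piFinSuccAbove (fun _ : Fin (n + 1) => ℝ) 0).measure_preimage
      hmeas.nullMeasurableSet, Measure.volume_eq_prod, Measure.prod_apply hmeas]
    have hslice : ∀ t : ℝ, volume (Prod.mk t ⁻¹' {p : ℝ × (Fin n → ℝ) |
        0 ≤ p.1 ∧ (∀ i, 0 ≤ p.2 i) ∧ p.1 + ∑ i, p.2 i ≤ s}) =
        (Icc 0 s).indicator (fun t => ENNReal.ofReal ((s - t) ^ n / n.factorial)) t := by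
      intro t
      by_cases ht : t ∈ Icc 0 s
      · rw [indicator_of_mem ht, ← ih (s - t) (by linarith [ht.2])]
        congr 1
        ext x
        simp [ht.1, le_sub_iff_add_le']
      · rw [indicator_of_notMem ht]
        refine measure_mono_null (t := ∅) (fun x hx => ht ?_) measure_empty
        have h := Finset.sum_nonneg fun i (_ : i ∈ Finset.univ) => hx.2.1 i
        exact ⟨hx.1, by linarith [hx.2.2]⟩
    simp_rw [hslice]
    rw [lintegral_indicator measurableSet_Icc, ← ofReal_integral_eq_lintegral_ofReal]
    · congr 1
      rw [integral_Icc_eq_integral_Ioc, ← intervalIntegral.integral_of_le hs]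
      simp only [intervalIntegral.integral_div]
      rw [intervalIntegral.integral_comp_sub_left (fun x => x ^ n) s]
      simp [Nat.factorial_succ]
      field_simp
    · exact (Continuous.continuousOn (by fun_prop)).integrableOn_compact isCompact_Icc
    · filter_upwards [ae_restrict_mem measurableSet_Icc] with t ht
      have : 0 ≤ s - t := by linarith [ht.2]
      positivity

/-- The matrix with rows `(1, X i)`. -/
noncomputable def homMatrix {d : ℕ} (X : Fin (d + 1) → EuclideanSpace ℝ (Fin d)) :
    Matrix (Fin (d + 1)) (Fin (d + 1)) ℝ :=
  Matrix.of fun i => Fin.cons 1 fun j => X i j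

/-- The edge vectors of a simplex at its zeroth vertex, as rows. -/
noncomputable def edgeMatrix {d : ℕ} (X : Fin (d + 1) → EuclideanSpace ℝ (Fin d)) :
    Matrix (Fin d) (Fin d) ℝ :=
  Matrix.of fun i j => X i.succ j - X 0 j

theorem det_homMatrix {d : ℕ} (X : Fin (d + 1) → EuclideanSpace ℝ (Fin d)) :
    (homMatrix X).det = (edgeMatrix X).det := by
  let B : Matrix (Fin (d + 1)) (Fin (d + 1)) ℝ := Matrix.of fun i j =>
    if i = 0 then homMatrix X 0 j else homMatrix X i j - homMatrix X 0 j
  have h : (homMatrix X).det = B.det := by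
    refine Matrix.det_eq_of_forall_row_eq_smul_add_const (fun i => if i = 0 then 0 else 1) 0
      (by simp) fun i j => ?_
    by_cases hi : i = 0 <;> simp [B, hi]
  rw [h, Matrix.det_succ_column_zero, Fin.sum_univ_succ, Finset.sum_eq_zero]
  · simp only [B, homMatrix, edgeMatrix]
    simp
    congr 1
  · intro i _
    simp [B, homMatrix, Fin.succ_ne_zero]

theorem mem_convexHull_range_iff {ι E : Type*} [Fintype ι] [AddCommGroup E]
    [Module ℝ E] (X : ι → E) (y : E) :
    y ∈ convexHull ℝ (Set.range X) ↔ ∃ w ∈ stdSimplex ℝ ι, ∑ i, w i • X i = y := by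
  classical
  have : Set.range X = Fintype.linearCombination ℝ X '' Set.range fun i : ι => Pi.single i 1 := by
    rw [← Set.range_comp]
    congr 1
    ext i
    simp [Fintype.linearCombination_apply_single]
  rw [this, ← LinearMap.image_convexHull, convexHull_rangle_single_eq_stdSimplex]
  simp [Fintype.linearCombination_apply]

/-- The volume of a simplex. -/
theorem volume_convexHull_range {d : ℕ} (X : Fin (d + 1) → EuclideanSpace ℝ (Fin d)) :
    volume (convexHull ℝ (Set.range X)) =
      ENNReal.ofReal (|(homMatrix X).det| / d.factorial) := by
  have himage : convexHull ℝ (Set.range X) = (MeasurableEquiv.toLp 2 (Fin d → ℝ)).symm ⁻¹'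
      ((fun v => v + -(X 0).ofLp) ⁻¹' (Matrix.toLin' (edgeMatrix X).transpose ''
        {x : Fin d → ℝ | (∀ i, 0 ≤ x i) ∧ ∑ i, x i ≤ 1})) := by
    have key : ∀ (x : Fin d → ℝ) (t : ℝ) (y : EuclideanSpace ℝ (Fin d)), t + ∑ i, x i = 1 →
        (t • X 0 + ∑ i, x i • X i.succ = y ↔
        Matrix.toLin' (edgeMatrix X).transpose x = y.ofLp + -(X 0).ofLp) := by
      intro x t y h
      rw [← sub_eq_add_neg, eq_sub_iff_add_eq, ← WithLp.ofLp_injective 2 |>.eq_iff]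
      suffices (t • X 0 + ∑ i, x i • X i.succ).ofLp =
        (Matrix.toLin' (edgeMatrix X).transpose) x + (X 0).ofLp by rw [this]
      ext j
      obtain rfl : t = 1 - ∑ i, x i := by linarith
      simp [Matrix.mulVec, dotProduct, edgeMatrix, sub_mul, mul_sub, Finset.sum_sub_distrib,
        Finset.sum_mul, mul_comm]
      ring
    ext y
    rw [mem_convexHull_range_iff]
    simp only [Set.mem_preimage, Set.mem_image]
    constructor
    · rintro ⟨w, ⟨hw0, hw1⟩, rfl⟩
      refine ⟨fun i => w i.succ, ⟨fun i => hw0 _, ?_⟩, ?_⟩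
      · rw [Fin.sum_univ_succ] at hw1
        linarith [hw0 0]
      · rw [Fin.sum_univ_succ] at hw1 ⊢
        exact (key _ _ _ hw1).1 rfl
    · rintro ⟨x, ⟨hx0, hx1⟩, hx⟩
      refine ⟨Fin.cons (1 - ∑ i, x i) x, ⟨fun i => ?_, ?_⟩, ?_⟩
      · refine Fin.cases ?_ (fun i => ?_) i
        · simpa using hx1
        · simpa using hx0 i
      · simp [Fin.sum_univ_succ]
      · rw [Fin.sum_univ_succ]
        exact (key _ _ _ (by simp)).2 hx
  rw [himage, (EuclideanSpace.volume_preserving_symm_measurableEquiv_toLp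
    (Fin d)).measure_preimage_equiv, measure_preimage_add_right,
    Measure.addHaar_image_linearMap, volume_corner_simplex d 1 zero_le_one, LinearMap.det_toLin',
    Matrix.det_transpose, det_homMatrix, ← ENNReal.ofReal_mul (abs_nonneg _)]
  congr 1
  ring

theorem continuous_det_homMatrix (d : ℕ) :
    Continuous fun X : Fin (d + 1) → EuclideanSpace ℝ (Fin d) => (homMatrix X).det := by
  simp_rw [det_homMatrix]
  refine Continuous.matrix_det (continuous_matrix fun i j => ?_)
  simp only [edgeMatrix, Matrix.of_apply]
  fun_prop

theorem finite_setOf_det_add_smul_one_eq_zero {n : Type*} [Fintype n] [DecidableEq n]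
    (A : Matrix n n ℝ) : {c : ℝ | (A + c • 1).det = 0}.Finite := by
  refine (A.charpoly.rootSet_finite ℝ).preimage (f := Neg.neg) neg_injective.injOn |>.subset ?_
  intro c hc
  rw [Set.mem_preimage, Polynomial.mem_rootSet]
  refine ⟨A.charpoly_monic.ne_zero, ?_⟩
  have : Matrix.scalar n (-c) - A = -(A + c • 1) := by
    ext i j
    simp [Matrix.scalar_apply, Matrix.one_apply, Matrix.diagonal_apply]
    split_ifs <;> ring
  rw [Polynomial.coe_aeval_eq_eval, Matrix.eval_charpoly, this, Matrix.det_neg,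
    Set.mem_ofPred.1 hc, mul_zero]

/-- Almost all `d + 1` points in `ℝᵈ` are affinely independent. -/
theorem ae_det_homMatrix_ne_zero (d : ℕ) :
    ∀ᵐ X : Fin (d + 1) → EuclideanSpace ℝ (Fin d), (homMatrix X).det ≠ 0 := by
  let Z : Fin (d + 1) → EuclideanSpace ℝ (Fin d) :=
    Fin.cons 0 fun i => EuclideanSpace.single i 1
  have hcont : Continuous fun q : (Fin (d + 1) → EuclideanSpace ℝ (Fin d)) × ℝ =>
      (homMatrix (q.1 + q.2 • Z)).det :=
    (continuous_det_homMatrix d).comp (by fun_prop)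
  have hmeas : MeasurableSet {q : (Fin (d + 1) → EuclideanSpace ℝ (Fin d)) × ℝ |
      (homMatrix (q.1 + q.2 • Z)).det ≠ 0} :=
    (isOpen_ne_fun hcont continuous_const).measurableSet
  have h1 : ∀ᵐ X : Fin (d + 1) → EuclideanSpace ℝ (Fin d), ∀ᵐ c : ℝ,
      (homMatrix (X + c • Z)).det ≠ 0 := by
    refine Filter.Eventually.of_forall fun X => ?_
    have hfin := finite_setOf_det_add_smul_one_eq_zero (edgeMatrix X)
    refine (measure_mono_null (fun c hc => ?_) (hfin.measure_zero volume))
    have hc' : (homMatrix (X + c • Z)).det = 0 := by simpa using hc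
    rw [det_homMatrix] at hc'
    rw [Set.mem_ofPred, ← hc']
    congr 1
    ext i j
    simp [edgeMatrix, Z, Matrix.one_apply, eq_comm]
    ring
  obtain ⟨c, hc⟩ := ((Measure.ae_ae_comm hmeas).1 h1).exists
  rw [← map_add_right_eq_self volume (c • Z),
    ae_map_iff (by fun_prop)
      (isOpen_ne_fun (continuous_det_homMatrix d) continuous_const).measurableSet]
  exact hc

/-- The volume of the unit ball of `ℝⁿ`. -/
noncomputable def unitBallVolume (n : ℕ) : ℝ :=
  √Real.pi ^ n / Real.Gamma (n / 2 + 1)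

theorem unitBallVolume_pos (n : ℕ) : 0 < unitBallVolume n := by
  have := Real.Gamma_pos_of_pos (s := (n : ℝ) / 2 + 1) (by positivity)
  unfold unitBallVolume
  positivity

/-- The integral of `(1 - t²)^(n/2)` over `[-1, 1]`. -/
noncomputable def sliceIntegral (n : ℕ) : ENNReal :=
  ∫⁻ t : ℝ, ENNReal.ofReal √(1 - t ^ 2) ^ n

theorem isOpen_prod_ball (E : Type*) [SeminormedAddCommGroup E] :
    IsOpen {p : E × ℝ | ‖p.1‖ ^ 2 + p.2 ^ 2 < 1} :=
  isOpen_lt (by fun_prop) (by fun_prop)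

section Slices

variable (E : Type*) [NormedAddCommGroup E] [InnerProductSpace ℝ E] [FiniteDimensional ℝ E]
  [MeasurableSpace E] [BorelSpace E]

theorem volume_prod_ball :
    volume {p : E × ℝ | ‖p.1‖ ^ 2 + p.2 ^ 2 < 1} =
      ENNReal.ofReal (unitBallVolume (Module.finrank ℝ E + 1)) := by
  have hfin : Module.finrank ℝ (WithLp 2 (E × ℝ)) = Module.finrank ℝ E + 1 := by
    rw [(WithLp.linearEquiv 2 ℝ (E × ℝ)).finrank_eq]
    simp
  have : Nontrivial (WithLp 2 (E × ℝ)) := Module.nontrivial_of_finrank_pos (R := ℝ) (by omega)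
  have h := InnerProductSpace.volume_ball (0 : WithLp 2 (E × ℝ)) 1
  rw [← (WithLp.volume_preserving_toLp E ℝ).measure_preimage
    measurableSet_ball.nullMeasurableSet, hfin] at h
  rw [unitBallVolume]
  convert h using 2
  · ext p
    simp [WithLp.prod_norm_eq_of_L2, Real.sqrt_lt']
  · simp

variable [Nontrivial E]

theorem volume_setOf_norm_sq_lt (s : ℝ) :
    volume {x : E | ‖x‖ ^ 2 < s} = ENNReal.ofReal √s ^ Module.finrank ℝ E *
      ENNReal.ofReal (unitBallVolume (Module.finrank ℝ E)) := by
  rw [unitBallVolume, ← InnerProductSpace.volume_ball (0 : E)]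
  congr 1
  ext x
  simp [Real.lt_sqrt]

theorem sliceIntegral_mul_unitBallVolume_finrank :
    sliceIntegral (Module.finrank ℝ E) * ENNReal.ofReal (unitBallVolume (Module.finrank ℝ E)) =
      ENNReal.ofReal (unitBallVolume (Module.finrank ℝ E + 1)) := by
  rw [← volume_prod_ball E, Measure.volume_eq_prod,
    Measure.prod_apply_symm (isOpen_prod_ball E).measurableSet, sliceIntegral,
    ← lintegral_mul_const _ (by fun_prop)]
  refine lintegral_congr fun t => ?_
  rw [← volume_setOf_norm_sq_lt]
  congr 1
  ext x
  simp [lt_sub_iff_add_lt]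

end Slices

theorem sliceIntegral_mul_unitBallVolume {n : ℕ} (hn : 1 ≤ n) :
    sliceIntegral n * ENNReal.ofReal (unitBallVolume n) =
      ENNReal.ofReal (unitBallVolume (n + 1)) := by
  have : Nonempty (Fin n) := Fin.pos_iff_nonempty.1 hn
  simpa using sliceIntegral_mul_unitBallVolume_finrank (EuclideanSpace ℝ (Fin n))

theorem lintegral_abs_pow_Ioo {ρ : ℝ} (hρ : 0 ≤ ρ) (n : ℕ) :
    ∫⁻ t in Set.Ioo (-ρ) ρ, ENNReal.ofReal (|t| ^ n) =
      ENNReal.ofReal (2 / (n + 1)) * ENNReal.ofReal ρ ^ (n + 1) := by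
  rw [← ENNReal.ofReal_pow hρ, ← ENNReal.ofReal_mul (by positivity),
    ← ofReal_integral_eq_lintegral_ofReal]
  · congr 1
    rw [← integral_Ioc_eq_integral_Ioo, ← intervalIntegral.integral_of_le (by linarith),
      ← intervalIntegral.integral_add_adjacent_intervals (b := 0)
      (Continuous.intervalIntegrable (by fun_prop) _ _)
      (Continuous.intervalIntegrable (by fun_prop) _ _),
      intervalIntegral.integral_of_le (by linarith), intervalIntegral.integral_of_le hρ,
      ← Set.uIoc_of_le hρ, ← Set.uIoc_of_le (by linarith : -ρ ≤ 0), Set.uIoc_comm]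
    have h1 := integral_pow_abs_sub_uIoc (a := 0) (b := ρ) (n := n)
    have h2 := integral_pow_abs_sub_uIoc (a := 0) (b := -ρ) (n := n)
    simp only [sub_zero, abs_neg, abs_of_nonneg hρ] at h1 h2
    rw [h1, h2]
    ring
  · exact (Continuous.integrableOn_Icc (by fun_prop)).mono_set Set.Ioo_subset_Icc_self
  · exact Filter.Eventually.of_forall fun t => by positivity

/-- Gnomonic projection: the integral of `(1 + |a|²)^(-(d+1)/2)` is half the area of a sphere. -/
theorem lintegral_inv_sqrt_one_add_norm_sq (E : Type*) [NormedAddCommGroup E]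
    [InnerProductSpace ℝ E] [FiniteDimensional ℝ E] [MeasurableSpace E] [BorelSpace E] :
    ENNReal.ofReal (2 / (Module.finrank ℝ E + 1)) *
      ∫⁻ a : E, ENNReal.ofReal (√(1 + ‖a‖ ^ 2))⁻¹ ^ (Module.finrank ℝ E + 1) =
      ENNReal.ofReal (unitBallVolume (Module.finrank ℝ E + 1)) := by
  set n := Module.finrank ℝ E with hn
  have hmeas : MeasurableSet {p : ℝ × E | p.1 ^ 2 * (1 + ‖p.2‖ ^ 2) < 1} :=
    (isOpen_lt (by fun_prop) (by fun_prop)).measurableSet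
  have hslice : ∀ t : ℝ, t ≠ 0 →
      volume ((fun x : E => (x, t)) ⁻¹' {p : E × ℝ | ‖p.1‖ ^ 2 + p.2 ^ 2 < 1}) =
      ∫⁻ a : E, {p : ℝ × E | p.1 ^ 2 * (1 + ‖p.2‖ ^ 2) < 1}.indicator
        (fun p => ENNReal.ofReal (|p.1| ^ n)) (t, a) := by
    intro t ht
    have : (fun x : E => (x, t)) ⁻¹' {p : E × ℝ | ‖p.1‖ ^ 2 + p.2 ^ 2 < 1} =
        (t⁻¹ • ·) ⁻¹' {a : E | t ^ 2 * (1 + ‖a‖ ^ 2) < 1} := by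
      ext x
      have : t ^ 2 * (1 + (|t|⁻¹ * ‖x‖) ^ 2) = ‖x‖ ^ 2 + t ^ 2 := by
        rw [mul_pow, inv_pow, sq_abs]; field_simp; ring
      simp [norm_smul, this]
    rw [this, Measure.addHaar_preimage_smul _ (inv_ne_zero ht), ← hn]
    have hm : MeasurableSet {a : E | t ^ 2 * (1 + ‖a‖ ^ 2) < 1} :=
      (isOpen_lt (by fun_prop) (by fun_prop)).measurableSet
    have hi : ∀ a : E, {p : ℝ × E | p.1 ^ 2 * (1 + ‖p.2‖ ^ 2) < 1}.indicator
        (fun p => ENNReal.ofReal (|p.1| ^ n)) (t, a) =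
        {a : E | t ^ 2 * (1 + ‖a‖ ^ 2) < 1}.indicator (fun _ => ENNReal.ofReal (|t| ^ n)) a :=
      fun a => rfl
    simp_rw [hi]
    rw [lintegral_indicator hm, setLIntegral_const]
    simp
  rw [← volume_prod_ball E, Measure.volume_eq_prod,
    Measure.prod_apply_symm (isOpen_prod_ball E).measurableSet]
  have hae : ∀ᵐ t : ℝ, t ≠ 0 := by simp [ae_iff]
  rw [lintegral_congr_ae (hae.mono hslice), lintegral_lintegral_swap,
    ← lintegral_const_mul _ (by fun_prop)]
  · refine lintegral_congr fun a => ?_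
    have hq : (0 : ℝ) < √(1 + ‖a‖ ^ 2) := by positivity
    rw [← lintegral_abs_pow_Ioo (by positivity), ← lintegral_indicator measurableSet_Ioo]
    refine lintegral_congr fun t => ?_
    have : t ∈ Set.Ioo (-(√(1 + ‖a‖ ^ 2))⁻¹) (√(1 + ‖a‖ ^ 2))⁻¹ ↔
        (t, a) ∈ {p : ℝ × E | p.1 ^ 2 * (1 + ‖p.2‖ ^ 2) < 1} := by
      rw [Set.mem_Ioo, ← abs_lt, ← sq_lt_sq₀ (abs_nonneg _) (by positivity), sq_abs, inv_pow,
        Real.sq_sqrt (by positivity), ← one_div, lt_div_iff₀ (by positivity)]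
      rfl
    by_cases h : t ∈ Set.Ioo (-(√(1 + ‖a‖ ^ 2))⁻¹) (√(1 + ‖a‖ ^ 2))⁻¹
    · rw [Set.indicator_of_mem h, Set.indicator_of_mem (this.1 h)]
    · rw [Set.indicator_of_notMem h, Set.indicator_of_notMem (this.not.1 h)]
  · exact (Measurable.indicator (by fun_prop) hmeas).aemeasurable

/-- The projection to `E` of the section of the unit ball of `E × ℝ` by the graph of
`x ↦ b + ⟪x, a⟫`. -/
def graphSection {E : Type*} [NormedAddCommGroup E] [InnerProductSpace ℝ E] (a : E) (b : ℝ) :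
    Set E :=
  {x | ‖x‖ ^ 2 + (b + inner ℝ x a) ^ 2 < 1}

/-- The integral of `d!` times the simplex volume over all `(d + 1)`-tuples from `s`. -/
noncomputable def simplexIntegral {d : ℕ} (s : Set (EuclideanSpace ℝ (Fin d))) : ENNReal :=
  ∫⁻ X in Set.univ.pi fun _ : Fin (d + 1) => s, ENNReal.ofReal |(homMatrix X).det|

theorem isOpen_setOf_forall_mem_graphSection (ι E : Type*) [Finite ι] [NormedAddCommGroup E]
    [InnerProductSpace ℝ E] :
    IsOpen {q : (ι → E) × (E × ℝ) | ∀ i, q.1 i ∈ graphSection q.2.1 q.2.2} := by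
  simp only [Set.ofPred_forall]
  refine isOpen_iInter_of_finite fun i => ?_
  simp only [graphSection, Set.mem_ofPred]
  exact isOpen_lt (by fun_prop) (by fun_prop)

theorem measurePreserving_cons (d : ℕ) :
    MeasurePreserving (fun w : EuclideanSpace ℝ (Fin d) × ℝ =>
      (Fin.cons w.2 w.1.ofLp : Fin (d + 1) → ℝ)) := by
  have h1 : MeasurePreserving (Prod.swap : EuclideanSpace ℝ (Fin d) × ℝ → _) :=
    Measure.measurePreserving_swap
  have h2 := (MeasurePreserving.id (volume : Measure ℝ)).prod (PiLp.volume_preserving_ofLp (Fin d))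
  have h3 := (volume_preserving_piFinSuccAbove (fun _ : Fin (d + 1) => ℝ) 0).symm
  convert h3.comp (h2.comp h1) using 1
  ext w i
  simp [MeasurableEquiv.piFinSuccAbove]

theorem homMatrix_mulVec_cons {d : ℕ} (X : Fin (d + 1) → EuclideanSpace ℝ (Fin d))
    (a : EuclideanSpace ℝ (Fin d)) (b : ℝ) (i : Fin (d + 1)) :
    (homMatrix X).mulVec (Fin.cons b a.ofLp) i = b + inner ℝ (X i) a := by
  simp [Matrix.mulVec, dotProduct, homMatrix, Fin.sum_univ_succ, PiLp.inner_apply, mul_comm]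

theorem volume_setOf_forall_mem_prod_ball {d : ℕ} (X : Fin (d + 1) → EuclideanSpace ℝ (Fin d))
    (hX : (homMatrix X).det ≠ 0) :
    volume {t : Fin (d + 1) → ℝ | ∀ i, ‖X i‖ ^ 2 + t i ^ 2 < 1} =
      ENNReal.ofReal |(homMatrix X).det| *
        volume {w : EuclideanSpace ℝ (Fin d) × ℝ | ∀ i, X i ∈ graphSection w.1 w.2} := by
  have hopen : IsOpen {t : Fin (d + 1) → ℝ | ∀ i, ‖X i‖ ^ 2 + t i ^ 2 < 1} := by
    simp only [Set.ofPred_forall]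
    exact isOpen_iInter_of_finite fun i => isOpen_lt (by fun_prop) (by fun_prop)
  have hdet : LinearMap.det (Matrix.toLin' (homMatrix X)) ≠ 0 := by rwa [LinearMap.det_toLin']
  have hset : {w : EuclideanSpace ℝ (Fin d) × ℝ | ∀ i, X i ∈ graphSection w.1 w.2} =
      (fun w : EuclideanSpace ℝ (Fin d) × ℝ => (Fin.cons w.2 w.1.ofLp : Fin (d + 1) → ℝ)) ⁻¹'
      (Matrix.toLin' (homMatrix X) ⁻¹' {t | ∀ i, ‖X i‖ ^ 2 + t i ^ 2 < 1}) := by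
    ext w
    simp [graphSection, homMatrix_mulVec_cons]
  rw [hset, (measurePreserving_cons d).measure_preimage
    (hopen.preimage (LinearMap.continuous_of_finiteDimensional _)).measurableSet.nullMeasurableSet,
    Measure.addHaar_preimage_linearMap _ hdet, LinearMap.det_toLin', ← mul_assoc,
    ← ENNReal.ofReal_mul (abs_nonneg _), ← abs_mul, mul_inv_cancel₀ hX]
  simp

/-- The affine Blaschke–Petkantschin formula for hyperplane sections of the unit ball. -/
theorem lintegral_simplexIntegral_graphSection (d : ℕ) :
    ∫⁻ a : EuclideanSpace ℝ (Fin d), ∫⁻ b : ℝ, simplexIntegral (graphSection a b) =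
      ENNReal.ofReal (unitBallVolume (d + 1)) ^ (d + 1) := by
  have hU := (isOpen_setOf_forall_mem_graphSection (Fin (d + 1))
    (EuclideanSpace ℝ (Fin d))).measurableSet
  have hT : IsOpen {q : (Fin (d + 1) → EuclideanSpace ℝ (Fin d)) × (Fin (d + 1) → ℝ) |
      ∀ i, ‖q.1 i‖ ^ 2 + q.2 i ^ 2 < 1} := by
    simp only [Set.ofPred_forall]
    exact isOpen_iInter_of_finite fun i => isOpen_lt (by fun_prop) (by fun_prop)
  set f : (Fin (d + 1) → EuclideanSpace ℝ (Fin d)) → EuclideanSpace ℝ (Fin d) × ℝ → ENNReal :=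
    fun X w => {q : (Fin (d + 1) → EuclideanSpace ℝ (Fin d)) × (EuclideanSpace ℝ (Fin d) × ℝ) |
      ∀ i, q.1 i ∈ graphSection q.2.1 q.2.2}.indicator
        (fun q => ENNReal.ofReal |(homMatrix q.1).det|) (X, w) with hf
  have hdet := (continuous_det_homMatrix d).measurable
  have hfm : Measurable (Function.uncurry f) := by
    refine Measurable.indicator ?_ hU
    exact (hdet.comp measurable_fst).abs.ennreal_ofReal
  have hball : ENNReal.ofReal (unitBallVolume (d + 1)) ^ (d + 1) =
      volume (Set.univ.pi fun _ : Fin (d + 1) =>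
        {p : EuclideanSpace ℝ (Fin d) × ℝ | ‖p.1‖ ^ 2 + p.2 ^ 2 < 1}) := by
    simp [volume_pi_pi, volume_prod_ball]
  have hpre : (Set.univ.pi fun _ : Fin (d + 1) =>
        {p : EuclideanSpace ℝ (Fin d) × ℝ | ‖p.1‖ ^ 2 + p.2 ^ 2 < 1}) =
      MeasurableEquiv.arrowProdEquivProdArrow (EuclideanSpace ℝ (Fin d)) ℝ (Fin (d + 1)) ⁻¹'
        {q | ∀ i, ‖q.1 i‖ ^ 2 + q.2 i ^ 2 < 1} := by
    ext Y
    simp [MeasurableEquiv.arrowProdEquivProdArrow, Equiv.arrowProdEquivProdArrow]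
  rw [hball, hpre, (volume_measurePreserving_arrowProdEquivProdArrow (EuclideanSpace ℝ (Fin d)) ℝ
    (Fin (d + 1))).measure_preimage_equiv, Measure.volume_eq_prod,
    Measure.prod_apply hT.measurableSet]
  have hX : ∀ᵐ X : Fin (d + 1) → EuclideanSpace ℝ (Fin d),
      volume (Prod.mk X ⁻¹' {q : (Fin (d + 1) → EuclideanSpace ℝ (Fin d)) × (Fin (d + 1) → ℝ) |
        ∀ i, ‖q.1 i‖ ^ 2 + q.2 i ^ 2 < 1}) = ∫⁻ w, f X w := by
    filter_upwards [ae_det_homMatrix_ne_zero d] with X hX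
    have hi : ∀ w, f X w = {w : EuclideanSpace ℝ (Fin d) × ℝ |
        ∀ i, X i ∈ graphSection w.1 w.2}.indicator
          (fun _ => ENNReal.ofReal |(homMatrix X).det|) w := fun w => rfl
    have hm : MeasurableSet {w : EuclideanSpace ℝ (Fin d) × ℝ |
        ∀ i, X i ∈ graphSection w.1 w.2} := measurable_prodMk_left hU
    simp_rw [hi]
    rw [lintegral_indicator hm, setLIntegral_const,
      ← volume_setOf_forall_mem_prod_ball X hX]
    rfl
  have hg : Measurable fun w => ∫⁻ X, f X w := hfm.lintegral_prod_left'
  rw [lintegral_congr_ae hX, lintegral_lintegral_swap hfm.aemeasurable,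
    Measure.volume_eq_prod, lintegral_prod _ hg.aemeasurable]
  refine lintegral_congr fun a => lintegral_congr fun b => ?_
  have hs : MeasurableSet (Set.univ.pi fun _ : Fin (d + 1) => graphSection a b) := by
    refine MeasurableSet.univ_pi fun _ => ?_
    exact (isOpen_lt (by fun_prop) (by fun_prop)).measurableSet
  rw [simplexIntegral, ← lintegral_indicator hs]
  refine lintegral_congr fun X => ?_
  simp only [hf, Set.indicator]
  congr 1
  simp

theorem ofReal_abs_det_homMatrix {d : ℕ} (X : Fin (d + 1) → EuclideanSpace ℝ (Fin d)) :
    ENNReal.ofReal |(homMatrix X).det| =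
      d.factorial * volume (convexHull ℝ (Set.range X)) := by
  rw [volume_convexHull_range, ← ENNReal.ofReal_natCast, ← ENNReal.ofReal_mul (by positivity),
    mul_div_cancel₀ _ (by positivity)]

theorem ofReal_abs_det_homMatrix_affine {d : ℕ} (c : EuclideanSpace ℝ (Fin d))
    (L : EuclideanSpace ℝ (Fin d) →ₗ[ℝ] EuclideanSpace ℝ (Fin d))
    (X : Fin (d + 1) → EuclideanSpace ℝ (Fin d)) :
    ENNReal.ofReal |(homMatrix fun i => c + L (X i)).det| =
      ENNReal.ofReal |LinearMap.det L| * ENNReal.ofReal |(homMatrix X).det| := by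
  have : convexHull ℝ (Set.range fun i => c + L (X i)) =
      (c + ·) '' (L '' convexHull ℝ (Set.range X)) := by
    rw [LinearMap.image_convexHull, Set.image_add_left, ← Set.range_comp,
      ← Set.image_add_left, ← Set.singleton_add, ← convexHull_singleton (𝕜 := ℝ) c,
      ← convexHull_add, Set.singleton_add, ← Set.range_comp]
    rfl
  rw [ofReal_abs_det_homMatrix, this, Set.image_add_left, measure_preimage_add,
    Measure.addHaar_image_linearMap, ofReal_abs_det_homMatrix]
  ring

theorem volume_pi_eq_smul_map_affine {ι E : Type*} [Fintype ι] [NormedAddCommGroup E]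
    [InnerProductSpace ℝ E] [FiniteDimensional ℝ E] [MeasurableSpace E] [BorelSpace E]
    (c : E) (L : E →ₗ[ℝ] E) (hL : LinearMap.det L ≠ 0) :
    (volume : Measure (ι → E)) = ENNReal.ofReal |LinearMap.det L| ^ Fintype.card ι •
      Measure.map (fun X i => c + L (X i)) (volume : Measure (ι → E)) := by
  have hL' : Measurable L := L.continuous_of_finiteDimensional.measurable
  have hm : Measurable fun (X : ι → E) i => c + L (X i) :=
    measurable_pi_lambda _ fun i => measurable_const.add (hL'.comp (measurable_pi_apply i))
  rw [volume_pi]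
  refine Measure.pi_eq fun s hs => ?_
  have hpre : (fun (X : ι → E) i => c + L (X i)) ⁻¹' Set.univ.pi s =
      Set.univ.pi fun i => L ⁻¹' ((c + ·) ⁻¹' s i) := by
    ext X; simp
  rw [Measure.smul_apply, Measure.map_apply hm (MeasurableSet.univ_pi hs), hpre, Measure.pi_pi,
    smul_eq_mul, ← Finset.card_univ, ← Finset.prod_const, ← Finset.prod_mul_distrib]
  refine Finset.prod_congr rfl fun i _ => ?_
  rw [Measure.addHaar_preimage_linearMap _ hL, measure_preimage_add, ← mul_assoc,
    ← ENNReal.ofReal_mul (abs_nonneg _), ← abs_mul, mul_inv_cancel₀ hL]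
  simp

theorem simplexIntegral_affine {d : ℕ} {s t : Set (EuclideanSpace ℝ (Fin d))}
    (ht : MeasurableSet t) (c : EuclideanSpace ℝ (Fin d))
    (L : EuclideanSpace ℝ (Fin d) →ₗ[ℝ] EuclideanSpace ℝ (Fin d)) (hL : LinearMap.det L ≠ 0)
    (hst : ∀ z, c + L z ∈ t ↔ z ∈ s) :
    simplexIntegral t = ENNReal.ofReal |LinearMap.det L| ^ (d + 2) * simplexIntegral s := by
  have hL' : Measurable L := L.continuous_of_finiteDimensional.measurable
  have hm : Measurable fun (X : Fin (d + 1) → EuclideanSpace ℝ (Fin d)) i => c + L (X i) :=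
    measurable_pi_lambda _ fun i => measurable_const.add (hL'.comp (measurable_pi_apply i))
  have hdet := (continuous_det_homMatrix d).measurable.abs.ennreal_ofReal
  have ht' : MeasurableSet (Set.univ.pi fun _ : Fin (d + 1) => t) :=
    MeasurableSet.univ_pi fun _ => ht
  have hpre : (fun (X : Fin (d + 1) → EuclideanSpace ℝ (Fin d)) i => c + L (X i)) ⁻¹'
      (Set.univ.pi fun _ => t) = Set.univ.pi fun _ => s := by
    ext X; simp [hst]
  rw [simplexIntegral, volume_pi_eq_smul_map_affine c L hL, Measure.restrict_smul,
    lintegral_smul_measure, setLIntegral_map ht' hdet hm, hpre]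
  simp_rw [ofReal_abs_det_homMatrix_affine]
  rw [lintegral_const_mul _ hdet, simplexIntegral, Fintype.card_fin, smul_eq_mul]
  ring

theorem mem_graphSection_affine {E : Type*} [NormedAddCommGroup E] [InnerProductSpace ℝ E]
    (a : E) (b S : ℝ) (hS : 0 < S) (hSa : S ^ 2 = 1 + ‖a‖ ^ 2) {r : ℝ} (hr : 0 < r)
    (hrb : r ^ 2 = 1 - (S⁻¹ * b) ^ 2) (z : E) :
    -(b / S ^ 2) • a + (r • LinearMap.transvection (innerₛₗ ℝ a) (-(S * (S + 1))⁻¹ • a)) z ∈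
      graphSection a b ↔ z ∈ Metric.ball (0 : E) 1 := by
  have hkey : ‖-(b / S ^ 2) • a +
        (r • LinearMap.transvection (innerₛₗ ℝ a) (-(S * (S + 1))⁻¹ • a)) z‖ ^ 2 +
      (b + inner ℝ (-(b / S ^ 2) • a +
        (r • LinearMap.transvection (innerₛₗ ℝ a) (-(S * (S + 1))⁻¹ • a)) z) a) ^ 2 =
      (1 - r ^ 2) + r ^ 2 * ‖z‖ ^ 2 := by
    have ha : ‖a‖ ^ 2 = S ^ 2 - 1 := by linarith
    rw [← real_inner_self_eq_norm_sq]
    simp only [LinearMap.smul_apply, LinearMap.transvection.apply, innerₛₗ_apply_apply,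
      inner_add_left, inner_add_right, real_inner_smul_left, real_inner_smul_right, smul_add,
      real_inner_comm a z]
    simp only [real_inner_self_eq_norm_sq, ha]
    generalize inner ℝ a z = w
    generalize ‖z‖ = N
    have hS1 : S + 1 ≠ 0 := by positivity
    have hr2 : r ^ 2 = (S ^ 2 - b ^ 2) / S ^ 2 := by rw [hrb]; field_simp
    field_simp
    ring_nf
    simp only [hr2]
    field_simp
    ring
  rw [graphSection, Set.mem_ofPred, hkey, mem_ball_zero_iff, ← sq_lt_one_iff₀ (norm_nonneg z)]
  have := pow_pos hr 2
  constructor <;> intro h <;> nlinarith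

theorem det_transvection_graphSection {E : Type*} [NormedAddCommGroup E] [InnerProductSpace ℝ E]
    [FiniteDimensional ℝ E] (a : E) (S : ℝ) (hS : 0 < S) (hSa : S ^ 2 = 1 + ‖a‖ ^ 2) :
    LinearMap.det (LinearMap.transvection (innerₛₗ ℝ a) (-(S * (S + 1))⁻¹ • a)) = S⁻¹ := by
  have ha : ‖a‖ ^ 2 = S ^ 2 - 1 := by linarith
  rw [LinearMap.transvection.det, innerₛₗ_apply_apply, real_inner_smul_right,
    real_inner_self_eq_norm_sq, ha]
  field_simp
  ring

theorem simplexIntegral_graphSection {d : ℕ} (hd : 1 ≤ d) (a : EuclideanSpace ℝ (Fin d)) (b : ℝ) :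
    simplexIntegral (graphSection a b) =
      ENNReal.ofReal √(1 - ((√(1 + ‖a‖ ^ 2))⁻¹ * b) ^ 2) ^ (d * (d + 2)) *
      ENNReal.ofReal (√(1 + ‖a‖ ^ 2))⁻¹ ^ (d + 2) *
        simplexIntegral (Metric.ball (0 : EuclideanSpace ℝ (Fin d)) 1) := by
  have hS : 0 < √(1 + ‖a‖ ^ 2) := by positivity
  have hSa : √(1 + ‖a‖ ^ 2) ^ 2 = 1 + ‖a‖ ^ 2 := Real.sq_sqrt (by positivity)
  set S := √(1 + ‖a‖ ^ 2)
  have hmeas : MeasurableSet (graphSection a b) :=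
    (isOpen_lt (by fun_prop) (by fun_prop)).measurableSet
  rcases le_or_gt (1 - (S⁻¹ * b) ^ 2) 0 with h | h
  · have hempty : graphSection a b = ∅ := by
      refine Set.eq_empty_of_forall_notMem fun x hx => ?_
      rw [graphSection, Set.mem_ofPred] at hx
      set u := b + inner ℝ x a with hu
      have h1 : |u * inner ℝ x a| ≤ |u| * (‖x‖ * ‖a‖) := by
        rw [abs_mul]
        exact mul_le_mul_of_nonneg_left (abs_real_inner_le_norm x a) (abs_nonneg u)
      have h2 : (inner ℝ x a) ^ 2 ≤ (‖x‖ * ‖a‖) ^ 2 :=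
        sq_le_sq' (abs_le.1 (abs_real_inner_le_norm x a)).1 (real_inner_le_norm x a)
      have h3 : b ^ 2 ≤ (‖x‖ ^ 2 + u ^ 2) * S ^ 2 := by
        have : b = u - inner ℝ x a := by rw [hu]; ring
        rw [this, hSa]
        nlinarith [sq_nonneg (|u| * ‖a‖ - ‖x‖), sq_abs u, neg_abs_le (u * inner ℝ x a)]
      have h4 : 1 * S ^ 2 ≤ b ^ 2 := by
        rw [← le_div_iff₀ (by positivity)]
        calc 1 ≤ (S⁻¹ * b) ^ 2 := by linarith
          _ = b ^ 2 / S ^ 2 := by field_simp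
      nlinarith [pow_pos hS 2]
    rw [Real.sqrt_eq_zero_of_nonpos h, hempty, simplexIntegral, Set.univ_pi_empty]
    simp
    left
    omega
  · have hr := Real.sqrt_pos.2 h
    have hdet : LinearMap.det (√(1 - (S⁻¹ * b) ^ 2) •
        LinearMap.transvection (innerₛₗ ℝ a) (-(S * (S + 1))⁻¹ • a)) =
        √(1 - (S⁻¹ * b) ^ 2) ^ d * S⁻¹ := by
      rw [LinearMap.det_smul, det_transvection_graphSection a S hS hSa, finrank_euclideanSpace_fin]
    have hpos : 0 < √(1 - (S⁻¹ * b) ^ 2) ^ d * S⁻¹ := by positivity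
    rw [simplexIntegral_affine hmeas _ _ (by rw [hdet]; exact hpos.ne')
      (mem_graphSection_affine a b S hS hSa hr (Real.sq_sqrt h.le)), hdet, abs_of_pos hpos,
      ENNReal.ofReal_mul (by positivity), ENNReal.ofReal_pow hr.le, mul_pow, ← pow_mul]

theorem lintegral_comp_mul_left_real (f : ℝ → ENNReal) (hf : Measurable f) {c : ℝ} (hc : 0 < c) :
    ∫⁻ t, f (c⁻¹ * t) = ENNReal.ofReal c * ∫⁻ t, f t := by
  have h := Real.map_volume_mul_left (inv_ne_zero hc.ne')
  rw [← lintegral_map hf (by fun_prop), h, lintegral_smul_measure]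
  simp [abs_of_pos hc]

theorem simplexIntegral_ball_mul {d : ℕ} (hd : 1 ≤ d) :
    ENNReal.ofReal (2 / (d + 1)) * ENNReal.ofReal (unitBallVolume (d + 1)) ^ (d + 1) =
    ENNReal.ofReal (unitBallVolume (d + 1)) * sliceIntegral (d * (d + 2)) *
      simplexIntegral (Metric.ball (0 : EuclideanSpace ℝ (Fin d)) 1) := by
  have hK := lintegral_inv_sqrt_one_add_norm_sq (EuclideanSpace ℝ (Fin d))
  rw [finrank_euclideanSpace_fin] at hK
  rw [← lintegral_simplexIntegral_graphSection, ← hK, mul_assoc, mul_assoc]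
  congr 1
  rw [← lintegral_mul_const _ (by fun_prop)]
  refine lintegral_congr fun a => ?_
  have hq : 0 < √(1 + ‖a‖ ^ 2) := by positivity
  simp_rw [simplexIntegral_graphSection hd, mul_assoc]
  rw [lintegral_mul_const _ (by fun_prop), lintegral_comp_mul_left_real
    (fun h => ENNReal.ofReal √(1 - h ^ 2) ^ (d * (d + 2))) (by fun_prop) hq, ← sliceIntegral]
  have hone : ENNReal.ofReal √(1 + ‖a‖ ^ 2) * ENNReal.ofReal (√(1 + ‖a‖ ^ 2))⁻¹ = 1 := by
    rw [← ENNReal.ofReal_mul hq.le, mul_inv_cancel₀ hq.ne', ENNReal.ofReal_one]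
  calc _ = (ENNReal.ofReal √(1 + ‖a‖ ^ 2) * ENNReal.ofReal (√(1 + ‖a‖ ^ 2))⁻¹) *
        (ENNReal.ofReal (√(1 + ‖a‖ ^ 2))⁻¹ ^ (d + 1) * (sliceIntegral (d * (d + 2)) *
          simplexIntegral (Metric.ball (0 : EuclideanSpace ℝ (Fin d)) 1))) := by ring
    _ = _ := by rw [hone, one_mul]

theorem integral_volume_convexHull_range (d : ℕ) :
    ∫ X : Fin (d + 1) → EuclideanSpace ℝ (Fin d),
        (volume (convexHull ℝ (Set.range X))).toReal
        ∂Measure.pi (fun _ =>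
          volume.restrict (Metric.closedBall (0 : EuclideanSpace ℝ (Fin d)) 1)) =
      (simplexIntegral (Metric.ball (0 : EuclideanSpace ℝ (Fin d)) 1)).toReal / d.factorial := by
  have hball : (volume.restrict (Metric.closedBall (0 : EuclideanSpace ℝ (Fin d)) 1)) =
      volume.restrict (Metric.ball 0 1) :=
    Measure.restrict_congr_set (ae_eq_of_subset_of_measure_ge Metric.ball_subset_closedBall
      (Measure.addHaar_unitClosedBall_eq_addHaar_unitBall volume).le
      measurableSet_ball.nullMeasurableSet measure_closedBall_lt_top.ne).symm
  simp_rw [volume_convexHull_range]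
  rw [hball, ← Measure.restrict_pi_pi, ← volume_pi]
  have hdet := (continuous_det_homMatrix d).abs
  simp_rw [ENNReal.toReal_ofReal (div_nonneg (abs_nonneg _) (Nat.cast_nonneg _))]
  rw [integral_div, integral_eq_lintegral_of_nonneg_ae (.of_forall fun _ => abs_nonneg _)
    hdet.aestronglyMeasurable, simplexIntegral]

theorem toReal_volume_closedBall_eq_unitBallVolume {d : ℕ} (hd : 1 ≤ d) :
    (volume (Metric.closedBall (0 : EuclideanSpace ℝ (Fin d)) 1)).toReal = unitBallVolume d := by
  have : Nonempty (Fin d) := ⟨⟨0, hd⟩⟩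
  have h := unitBallVolume_pos d
  rw [unitBallVolume] at *
  rw [EuclideanSpace.volume_closedBall, Fintype.card_fin, ENNReal.ofReal_one, one_pow, one_mul,
    ENNReal.toReal_ofReal h.le]

theorem unitBallVolume_succ (n : ℕ) :
    unitBallVolume (n + 1) =
      √Real.pi ^ (n + 1) * 2 / ((n + 1) * Real.Gamma ((n + 1) / 2)) := by
  rw [unitBallVolume]
  push_cast
  rw [Real.Gamma_add_one (by positivity)]
  have := (Real.Gamma_pos_of_pos (s := ((n : ℝ) + 1) / 2) (by positivity)).ne'
  field_simp

theorem unitBallVolume_succ_eq_gamma (n : ℕ) :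
    unitBallVolume (n + 1) =
      √Real.pi ^ n * 2 ^ (n + 1) * Real.Gamma ((n + 2) / 2) / Real.Gamma (n + 2) := by
  have h := Real.Gamma_mul_Gamma_add_half (((n : ℝ) + 2) / 2)
  rw [show 2 * (((n : ℝ) + 2) / 2) = n + 2 by ring,
    show (1 : ℝ) - (n + 2) = -((n + 1 : ℕ) : ℝ) by push_cast; ring,
    Real.rpow_neg (by norm_num), Real.rpow_natCast] at h
  have h1 := Real.Gamma_pos_of_pos (s := ((n : ℝ) + 2) / 2) (by positivity)
  have h2 := Real.Gamma_pos_of_pos (s := ((n : ℝ) + 2)) (by positivity)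
  have h3 : 0 < √Real.pi := Real.sqrt_pos.2 Real.pi_pos
  rw [unitBallVolume, show ((n + 1 : ℕ) : ℝ) / 2 + 1 = (n + 2) / 2 + 1 / 2 by push_cast; ring,
    eq_div_of_mul_eq h1.ne' ((mul_comm _ _).trans h)]
  field_simp
  ring

/-- Kingman's formula: the expected volume of the simplex spanned by `d+1` i.i.d. uniform
random points in the unit ball `B_d`, normalized by `vol(B_d)`, equals
`2^d Γ((d+1)²/2)² Γ(d+1)^{d+1} / ((d+1)^{d−1} Γ((d+1)²) Γ((d+1)/2)^{2(d+1)})`.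
The expectation is expressed as the integral over `(B_d)^{d+1}` of the hull volume
divided by `vol(B_d)^{d+2}` (`d+1` factors normalizing the uniform points, one more
normalizing the volume). -/
theorem stmt_19 (d : ℕ) (hd : 1 ≤ d) :
    (∫ X : Fin (d + 1) → EuclideanSpace ℝ (Fin d),
        (volume (convexHull ℝ (Set.range X))).toReal
        ∂Measure.pi fun _ =>
          volume.restrict (Metric.closedBall (0 : EuclideanSpace ℝ (Fin d)) 1))
      / (volume (Metric.closedBall (0 : EuclideanSpace ℝ (Fin d)) 1)).toReal ^ (d + 2)
    = 2 ^ d * Real.Gamma (((d:ℝ) + 1) ^ 2 / 2) ^ 2 * Real.Gamma ((d:ℝ) + 1) ^ (d + 1) /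
        (((d:ℝ) + 1) ^ (d - 1) * Real.Gamma (((d:ℝ) + 1) ^ 2) *
          Real.Gamma (((d:ℝ) + 1) / 2) ^ (2 * (d + 1))) := by
  rw [integral_volume_convexHull_range, toReal_volume_closedBall_eq_unitBallVolume hd]
  have hI := congrArg ENNReal.toReal (simplexIntegral_ball_mul hd)
  have hS := congrArg ENNReal.toReal
    (sliceIntegral_mul_unitBallVolume (n := d * (d + 2)) (by nlinarith))
  simp only [ENNReal.toReal_mul, ENNReal.toReal_pow,
    ENNReal.toReal_ofReal (unitBallVolume_pos _).le] at hI hS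
  rw [ENNReal.toReal_ofReal (by positivity)] at hI
  generalize (simplexIntegral (Metric.ball (0 : EuclideanSpace ℝ (Fin d)) 1)).toReal = I at *
  generalize (sliceIntegral (d * (d + 2))).toReal = S at *
  rw [← Real.Gamma_nat_eq_factorial]
  obtain ⟨k, rfl⟩ := Nat.exists_eq_add_of_le' hd
  obtain ⟨m, hm⟩ : ∃ m, (k + 1) * (k + 1 + 2) = m + 1 := ⟨k * (k + 4) + 2, by ring⟩
  have hm' : (m : ℝ) + 2 = ((k + 1 : ℕ) + 1) ^ 2 := by
    have := congrArg (Nat.cast (R := ℝ)) hm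
    push_cast at this ⊢
    linarith
  have hκ := unitBallVolume_pos (k + 1 + 1)
  rw [pow_succ] at hI
  have hI' : 2 / (((k + 1 : ℕ) : ℝ) + 1) * unitBallVolume (k + 1 + 1) ^ (k + 1) = S * I := by
    apply mul_left_cancel₀ hκ.ne'
    linear_combination hI
  rw [hm, unitBallVolume_succ (m + 1), unitBallVolume_succ_eq_gamma m] at hS
  rw [unitBallVolume_succ (k + 1)] at hI'
  rw [unitBallVolume_succ_eq_gamma k]
  push_cast at *
  rw [show (m : ℝ) + 1 + 1 = m + 2 by ring, hm'] at hS
  rw [show (k : ℝ) + 1 + 1 = k + 2 by ring] at *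
  have hA := Real.Gamma_pos_of_pos (s := ((k : ℝ) + 2) / 2) (by positivity)
  have hG := Real.Gamma_pos_of_pos (s := (k : ℝ) + 2) (by positivity)
  have hP := Real.Gamma_pos_of_pos (s := ((k : ℝ) + 2) ^ 2 / 2) (by positivity)
  have hQ := Real.Gamma_pos_of_pos (s := ((k : ℝ) + 2) ^ 2) (by positivity)
  have hs : 0 < √Real.pi := Real.sqrt_pos.2 Real.pi_pos
  have hn : (0 : ℝ) < k + 2 := by positivity
  have hm2 : m = k * k + 4 * k + 2 := by nlinarith
  generalize Real.Gamma (((k : ℝ) + 2) / 2) = A at *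
  generalize Real.Gamma ((k : ℝ) + 2) = G at *
  generalize Real.Gamma (((k : ℝ) + 2) ^ 2 / 2) = P at *
  generalize Real.Gamma (((k : ℝ) + 2) ^ 2) = Q at *
  generalize √Real.pi = s at *
  generalize (k : ℝ) + 2 = n at *
  have hS' : S = s ^ 2 * 2 * Q / (n ^ 2 * P ^ 2 * 2 ^ (m + 1)) := by
    apply mul_right_cancel₀ (pow_ne_zero m hs.ne')
    rw [div_mul_eq_mul_div, eq_div_iff (by positivity)]
    field_simp at hS
    linear_combination hS
  rw [hS'] at hI'
  have hI2 : I = 2 / n * (s ^ (k + 1 + 1) * 2 / (n * A)) ^ (k + 1) *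
      (n ^ 2 * P ^ 2 * 2 ^ (m + 1)) / (s ^ 2 * 2 * Q) := by
    rw [hI']; field_simp
  rw [hI2, hm2]
  simp only [div_pow, mul_pow]
  field_simp
  ring
end
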